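/- Full cells: P₄π ∩ (𝒯°)³ ⊆ 𝒫_ω, P₆π ∩ (𝒯°)³ ⊆ 𝒫₁, and P₈π ∩ (𝒯°)³ ⊆ 𝒫_{ω²}. In other words, for every τ = ((α₁,α₂),(β₁,β₂),(γ₁,γ₂)) in P₄π (respectively P₆π, P₈π) with 0 < α₂ < α₁ < 2π, 0 < β₂ < β₁ < 2π and 0 < γ₂ < γ₁ < 2π, there exist A, B, C ∈ U(2,1), conjugate in U(2,1) to the standard lifts L(α₁,α₂), L(β₁,β₂), L(γ₁,γ₂) respectively, with A·B·C = ω·I₃ (respectively I₃, ω²·I₃). -/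

import Mathlib

open Real Matrix Set

noncomputable section

abbrev Pt : Type := ℝ × ℝ
abbrev Tri : Type := Pt × Pt × Pt

/-- Membership in `𝒯 = {(a₁,a₂) ∈ [0,2π)² : a₁ ≥ a₂}`. -/
def memT (p : Pt) : Prop :=
  0 ≤ p.1 ∧ p.1 < 2 * π ∧ 0 ≤ p.2 ∧ p.2 < 2 * π ∧ p.2 ≤ p.1

def memT3 (τ : Tri) : Prop := memT τ.1 ∧ memT τ.2.1 ∧ memT τ.2.2

/-- Membership in the interior `𝒯° = {(a₁,a₂) : 0 < a₂ < a₁ < 2π}`. -/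
def memTo (p : Pt) : Prop := 0 < p.2 ∧ p.2 < p.1 ∧ p.1 < 2 * π

def memTo3 (τ : Tri) : Prop := memTo τ.1 ∧ memTo τ.2.1 ∧ memTo τ.2.2

/-- The sum `S(τ) = α₁+α₂+β₁+β₂+γ₁+γ₂`. -/
def Sf (τ : Tri) : ℝ := τ.1.1 + τ.1.2 + τ.2.1.1 + τ.2.1.2 + τ.2.2.1 + τ.2.2.2

/-- The coordinate of a pair: index `0` is the first coordinate (subscript 1),
index `1` the second (subscript 2). -/
def coord (p : Pt) (i : Fin 2) : ℝ := if i = 0 then p.1 else p.2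

/-- `sg τ i j k = σ_{(i+1)(j+1)(k+1)}(τ) = α_i + β_j + γ_k` (indices in `Fin 2`,
index `0` ↔ subscript 1, index `1` ↔ subscript 2). -/
def sg (τ : Tri) (i j k : Fin 2) : ℝ := coord τ.1 i + coord τ.2.1 j + coord τ.2.2 k

/-- `Hf τ i j k = 2 σ_{ijk}(τ) − σ_{ī j̄ k̄}(τ)`, the complementary index being `i+1` in `Fin 2`. -/
def Hf (τ : Tri) (i j k : Fin 2) : ℝ := 2 * sg τ i j k - sg τ (i + 1) (j + 1) (k + 1)

abbrev M3 : Type := Matrix (Fin 3) (Fin 3) ℂ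

/-- The form J = diag(1, 1, −1). -/
def J3 : M3 := Matrix.diagonal ![1, 1, -1]

/-- Membership in U(2,1). -/
def memU21 (M : M3) : Prop := Mᴴ * J3 * M = J3

/-- The diagonal matrix E(a₁,a₂) = diag(e^{ia₁}, e^{ia₂}, 1). -/
def Emat (a₁ a₂ : ℝ) : M3 :=
  Matrix.diagonal ![Complex.exp (a₁ * Complex.I), Complex.exp (a₂ * Complex.I), 1]

/-- `M` is of elliptic type `(a₁,a₂)`: conjugate in U(2,1) to E(a₁,a₂). -/
def ellType (M : M3) (a₁ a₂ : ℝ) : Prop :=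
  ∃ P : M3, memU21 P ∧ M = P * Emat a₁ a₂ * P⁻¹

/-- The standard lift L(a₁,a₂) = diag(e^{i(2a₁−a₂)/3}, e^{i(2a₂−a₁)/3}, e^{−i(a₁+a₂)/3}). -/
def Lmat (a₁ a₂ : ℝ) : M3 :=
  Matrix.diagonal ![Complex.exp (((2 * a₁ - a₂) / 3) * Complex.I),
    Complex.exp (((2 * a₂ - a₁) / 3) * Complex.I),
    Complex.exp ((-(a₁ + a₂) / 3) * Complex.I)]

/-- ω = e^{2πi/3}. -/
def omg : ℂ := Complex.exp (2 * π * Complex.I / 3)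

/-- `𝒫ᵤ`: the solution set with standard lifts multiplying to `u·I₃`. -/
def Psol (u : ℂ) : Set Tri := {τ | memT3 τ ∧ ∃ A B C : M3,
  memU21 A ∧ memU21 B ∧ memU21 C ∧
  (∃ P : M3, memU21 P ∧ A = P * Lmat τ.1.1 τ.1.2 * P⁻¹) ∧
  (∃ P : M3, memU21 P ∧ B = P * Lmat τ.2.1.1 τ.2.1.2 * P⁻¹) ∧
  (∃ P : M3, memU21 P ∧ C = P * Lmat τ.2.2.1 τ.2.2.2 * P⁻¹) ∧
  A * B * C = u • (1 : M3)}

/-- The polytope P₄π. -/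
def P4 : Set Tri := {τ | memT3 τ ∧ (Hf τ 1 1 1 < -(4 * π) ∨
  (Sf τ < 4 * π ∧ Hf τ 0 1 1 < 2 * π ∧ Hf τ 1 0 1 < 2 * π ∧ Hf τ 1 1 0 < 2 * π ∧
    2 * π < Hf τ 0 0 0))}

/-- The polytope P₆π. -/
def P6 : Set Tri := {τ | memT3 τ ∧ Hf τ 1 1 1 < 0 ∧ 6 * π < Hf τ 0 0 0}

/-- The polytope P₈π. -/
def P8 : Set Tri := {τ | memT3 τ ∧ (10 * π < Hf τ 0 0 0 ∨
  (8 * π < Sf τ ∧ 4 * π < Hf τ 1 0 0 ∧ 4 * π < Hf τ 0 1 0 ∧ 4 * π < Hf τ 0 0 1 ∧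
    Hf τ 1 1 1 < 4 * π))}

/-! ### Matrix part -/

lemma J3_mul_J3 : J3 * J3 = 1 := by
  unfold J3
  rw [Matrix.diagonal_mul_diagonal, ← Matrix.diagonal_one]
  congr 1; funext i; fin_cases i <;> simp

lemma J3_conjTranspose : J3ᴴ = J3 := by
  unfold J3
  rw [Matrix.diagonal_conjTranspose]
  congr 1; funext i; fin_cases i <;> simp

lemma memU21_left {P : M3} (h : memU21 P) : (J3 * Pᴴ * J3) * P = 1 := by
  unfold memU21 at h
  rw [Matrix.mul_assoc, Matrix.mul_assoc, ← Matrix.mul_assoc Pᴴ, h, J3_mul_J3]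

lemma memU21_inv_eq {P : M3} (h : memU21 P) : P⁻¹ = J3 * Pᴴ * J3 :=
  Matrix.inv_eq_left_inv (memU21_left h)

lemma memU21_isUnit {P : M3} (h : memU21 P) : IsUnit P.det := by
  have := congrArg Matrix.det (memU21_left h)
  rw [Matrix.det_mul, Matrix.det_one] at this
  exact IsUnit.of_mul_eq_one_right _ this

lemma memU21_mul {P Q : M3} (hP : memU21 P) (hQ : memU21 Q) : memU21 (P * Q) := by
  unfold memU21 at *
  rw [Matrix.conjTranspose_mul]
  calc Qᴴ * Pᴴ * J3 * (P * Q) = Qᴴ * (Pᴴ * J3 * P) * Q := by noncomm_ring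
    _ = J3 := by rw [hP, hQ]

lemma memU21_conjT {P : M3} (h : memU21 P) : P * J3 * Pᴴ = J3 := by
  have h1 : P * (J3 * Pᴴ * J3) = 1 := mul_eq_one_comm.mp (memU21_left h)
  calc P * J3 * Pᴴ = P * (J3 * Pᴴ * J3) * J3 := by
        simp only [Matrix.mul_assoc, J3_mul_J3, Matrix.mul_one]
    _ = J3 := by rw [h1, Matrix.one_mul]

lemma memU21_inv {P : M3} (h : memU21 P) : memU21 P⁻¹ := by
  rw [memU21_inv_eq h]
  unfold memU21
  simp only [Matrix.conjTranspose_mul, J3_conjTranspose, Matrix.conjTranspose_conjTranspose]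
  have := memU21_conjT h
  calc J3 * (P * J3) * J3 * (J3 * Pᴴ * J3) = J3 * (P * J3 * (J3 * J3) * Pᴴ) * J3 := by noncomm_ring
    _ = J3 := by rw [J3_mul_J3, Matrix.mul_one, this, J3_mul_J3, Matrix.one_mul]

lemma memU21_one : memU21 1 := by simp [memU21]

lemma memU21_diag {a : Fin 3 → ℂ} (h : ∀ i, ‖a i‖ = 1) : memU21 (Matrix.diagonal a) := by
  unfold memU21 J3
  rw [Matrix.diagonal_conjTranspose, Matrix.diagonal_mul_diagonal, Matrix.diagonal_mul_diagonal]
  congr 1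
  funext i
  have h1 : (starRingEnd ℂ) (a i) * a i = 1 := by
    rw [← Complex.normSq_eq_conj_mul_self, Complex.normSq_eq_norm_sq, h]; simp
  have : star (a i) * a i = 1 := h1
  simp only [Pi.star_apply]
  rw [mul_right_comm, this, one_mul]

lemma memU21_det_ne {P : M3} (h : memU21 P) : P.det ≠ 0 := (memU21_isUnit h).ne_zero

/-- the characteristic polynomial of an element of U(2,1) -/
lemma charpoly_U21 {M : M3} (hM : memU21 M) (l : ℂ) :
    (M - l • (1 : M3)).det = -(l ^ 3 - M.trace * l ^ 2
      + M.det * (starRingEnd ℂ) M.trace * l - M.det) := by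
  have h1 : (M.adjugate).trace = M.det * (starRingEnd ℂ) M.trace := by
    have h2 : M.adjugate = M.det • (J3 * Mᴴ * J3) := by
      have := Matrix.adjugate_mul M
      calc M.adjugate = M.adjugate * (M * (J3 * Mᴴ * J3)) := by
            rw [mul_eq_one_comm.mp (memU21_left hM), Matrix.mul_one]
        _ = (M.adjugate * M) * (J3 * Mᴴ * J3) := (Matrix.mul_assoc _ _ _).symm
        _ = _ := by rw [this]; simp
    rw [h2, Matrix.trace_smul, Matrix.trace_mul_comm, ← Matrix.mul_assoc, J3_mul_J3,
      Matrix.one_mul, Matrix.trace_conjTranspose, smul_eq_mul]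
    rfl
  rw [← h1]
  rw [Matrix.det_fin_three, Matrix.trace_fin_three, Matrix.trace_fin_three,
    Matrix.det_fin_three, Matrix.adjugate_fin_three]
  simp [Matrix.sub_apply, Matrix.smul_apply, Matrix.one_apply]
  ring

/-- A vector orthogonal to a negative vector is positive. -/
lemma pos_of_orth_neg (u v : Fin 3 → ℂ) (hu : u ≠ 0)
    (hv : ‖v 0‖ ^ 2 + ‖v 1‖ ^ 2 - ‖v 2‖ ^ 2 < 0)
    (ho : star (v 0) * u 0 + star (v 1) * u 1 - star (v 2) * u 2 = 0) :
    0 < ‖u 0‖ ^ 2 + ‖u 1‖ ^ 2 - ‖u 2‖ ^ 2 := by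
  have h1 : star (v 2) * u 2 = star (v 0) * u 0 + star (v 1) * u 1 := by
    linear_combination -ho
  have h2 : ‖v 2‖ * ‖u 2‖ ≤ ‖v 0‖ * ‖u 0‖ + ‖v 1‖ * ‖u 1‖ := by
    have := norm_add_le (star (v 0) * u 0) (star (v 1) * u 1)
    rw [← h1] at this
    simpa [norm_mul] using this
  have n0 := norm_nonneg (v 0)
  have n1 := norm_nonneg (v 1)
  have n2 := norm_nonneg (v 2)
  have m0 := norm_nonneg (u 0)
  have m1 := norm_nonneg (u 1)
  have m2 := norm_nonneg (u 2)
  have hu' : ‖u 0‖ ≠ 0 ∨ ‖u 1‖ ≠ 0 ∨ ‖u 2‖ ≠ 0 := by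
    by_contra hcon
    push Not at hcon
    obtain ⟨e0, e1, e2⟩ := hcon
    apply hu
    funext i
    fin_cases i
    · simpa using e0
    · simpa using e1
    · simpa using e2
  generalize ‖v 0‖ = a at *
  generalize ‖v 1‖ = b at *
  generalize ‖v 2‖ = c at *
  generalize ‖u 0‖ = p at *
  generalize ‖u 1‖ = q at *
  generalize ‖u 2‖ = r at *
  have hc : 0 < c := by
    rcases n2.lt_or_eq with h | h
    · exact h
    · exfalso; nlinarith [sq_nonneg a, sq_nonneg b]
  by_contra hcon
  push Not at hcon
  have h3 : (c * r) ^ 2 ≤ (a * p + b * q) ^ 2 := pow_le_pow_left₀ (by positivity) h2 2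
  have h4 : (a * p + b * q) ^ 2 ≤ (a ^ 2 + b ^ 2) * (p ^ 2 + q ^ 2) := by
    nlinarith [sq_nonneg (a * q - b * p)]
  have h5 : (a ^ 2 + b ^ 2) * (p ^ 2 + q ^ 2) ≤ (a ^ 2 + b ^ 2) * r ^ 2 :=
    mul_le_mul_of_nonneg_left (by linarith) (by positivity)
  have h6 : (c ^ 2 - a ^ 2 - b ^ 2) * r ^ 2 ≤ 0 := by nlinarith
  have h7 : r ^ 2 ≤ 0 := by
    by_contra h8
    push Not at h8
    have : 0 < (c ^ 2 - a ^ 2 - b ^ 2) * r ^ 2 := mul_pos (by linarith) h8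
    linarith
  have r0 : r = 0 := by nlinarith [sq_nonneg r]
  have p0 : p = 0 := by nlinarith [sq_nonneg p, sq_nonneg q]
  have q0 : q = 0 := by nlinarith [sq_nonneg p, sq_nonneg q]
  rcases hu' with h | h | h <;> contradiction
/-! ### Diagonalisation in U(2,1) -/

/-- the hermitian form -/
def hf (u v : Fin 3 → ℂ) : ℂ := star (u 0) * v 0 + star (u 1) * v 1 - star (u 2) * v 2

lemma hf_eq (u v : Fin 3 → ℂ) : hf u v = star u ⬝ᵥ (J3 *ᵥ v) := by
  simp [hf, J3, Matrix.mulVec_diagonal, dotProduct, Fin.sum_univ_three]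
  ring

lemma hf_mulVec {M : M3} (hM : memU21 M) (u v : Fin 3 → ℂ) :
    hf (M *ᵥ u) (M *ᵥ v) = hf u v := by
  rw [hf_eq, hf_eq, Matrix.star_mulVec, Matrix.mulVec_mulVec, ← Matrix.dotProduct_mulVec,
    Matrix.mulVec_mulVec, ← Matrix.mul_assoc, hM]

lemma hf_smul (a b : ℂ) (u v : Fin 3 → ℂ) : hf (a • u) (b • v) = star a * b * hf u v := by
  simp [hf]; ring

lemma hf_self (u : Fin 3 → ℂ) :
    hf u u = ((‖u 0‖ ^ 2 + ‖u 1‖ ^ 2 - ‖u 2‖ ^ 2 : ℝ) : ℂ) := by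
  have h : ∀ z : ℂ, star z * z = ((‖z‖ ^ 2 : ℝ) : ℂ) := by
    intro z
    rw [← Complex.normSq_eq_norm_sq, Complex.normSq_eq_conj_mul_self]; rfl
  simp only [hf, h]; push_cast; ring

lemma unit_star {c : ℂ} (h : ‖c‖ = 1) : star c * c = 1 := by
  have h1 : (starRingEnd ℂ) c * c = 1 := by
    rw [← Complex.normSq_eq_conj_mul_self, Complex.normSq_eq_norm_sq, h]; simp
  exact h1

lemma bary_unique {c0 c1 c2 : ℂ} (h0 : ‖c0‖ = 1) (h1 : ‖c1‖ = 1) (h2 : ‖c2‖ = 1)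
    (h01 : c0 ≠ c1) (h02 : c0 ≠ c2) (h12 : c1 ≠ c2) {p q r : ℝ} (hs : p + q + r = 0)
    (hc : (p : ℂ) * c0 + q * c1 + r * c2 = 0) : r = 0 := by
  have e0 := unit_star h0
  have e1 := unit_star h1
  have e2 := unit_star h2
  have hs' : (p : ℂ) + q + r = 0 := by exact_mod_cast hs
  have hc' : (p : ℂ) * star c0 + q * star c1 + r * star c2 = 0 := by
    have := congrArg star hc
    simpa using this
  have : (r : ℂ) * ((c0 - c2) * (c1 - c2) * (c0 - c1)) = 0 := by
    linear_combination (c0 * c1 * c2 * (c0 - c1)) * hc'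
      + (-1) * (p * c1 * c2 * (c0 - c1)) * e0 - (q * c0 * c2 * (c0 - c1)) * e1
      - (r * c0 * c1 * (c0 - c1)) * e2
      + (c0 - c1) * c2 * hc - (c0-c1)*c2*(c0+c1) * hs'
  have h3 : (c0 - c2) * (c1 - c2) * (c0 - c1) ≠ 0 :=
    mul_ne_zero (mul_ne_zero (sub_ne_zero.mpr h02) (sub_ne_zero.mpr h12)) (sub_ne_zero.mpr h01)
  have h4 := (mul_eq_zero.mp this).resolve_right h3
  exact_mod_cast h4
lemma exists_eigvec {M : M3} (hM : memU21 M) {c : Fin 3 → ℂ} (hc : ∀ i, ‖c i‖ = 1)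
    (htr : M.trace = c 0 + c 1 + c 2) (hdet : M.det = c 0 * c 1 * c 2) (k : Fin 3) :
    ∃ v : Fin 3 → ℂ, v ≠ 0 ∧ M *ᵥ v = c k • v := by
  have h : (M - c k • (1 : M3)).det = 0 := by
    rw [charpoly_U21 hM, htr, hdet]
    have e0 := unit_star (hc 0)
    have e1 := unit_star (hc 1)
    have e2 := unit_star (hc 2)
    simp only [map_add]
    change starRingEnd ℂ (c 0) * c 0 = 1 at e0
    change starRingEnd ℂ (c 1) * c 1 = 1 at e1
    change starRingEnd ℂ (c 2) * c 2 = 1 at e2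
    have : c 0 * c 1 * c 2 * (starRingEnd ℂ (c 0) + starRingEnd ℂ (c 1) + starRingEnd ℂ (c 2))
        = c 1 * c 2 + c 0 * c 2 + c 0 * c 1 := by
      linear_combination c 1 * c 2 * e0 + c 0 * c 2 * e1 + c 0 * c 1 * e2
    rw [this]
    fin_cases k <;> simp <;> ring
  obtain ⟨v, hv, hv2⟩ := Matrix.exists_mulVec_eq_zero_iff.mpr h
  refine ⟨v, hv, ?_⟩
  rw [Matrix.sub_mulVec, Matrix.smul_mulVec, Matrix.one_mulVec] at hv2
  exact sub_eq_zero.mp hv2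

lemma eig_orth {M : M3} (hM : memU21 M) {a b : ℂ} (ha : ‖a‖ = 1) (hab : a ≠ b)
    {u v : Fin 3 → ℂ} (hu : M *ᵥ u = a • u) (hv : M *ᵥ v = b • v) : hf u v = 0 := by
  have h := hf_mulVec hM u v
  rw [hu, hv, hf_smul] at h
  have h1 : (b - a) * hf u v = 0 := by
    linear_combination a * h - b * hf u v * unit_star ha
  exact (mul_eq_zero.mp h1).resolve_left (sub_ne_zero.mpr hab.symm)

lemma diag_lemma {M : M3} (hM : memU21 M) {c : Fin 3 → ℂ} (hc : ∀ i, ‖c i‖ = 1)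
    (hinj : Function.Injective c)
    (htr : M.trace = c 0 + c 1 + c 2) (hdet : M.det = c 0 * c 1 * c 2)
    (f : Fin 3 → ℂ) (hff : hf f f = -1) (w0 w1 w2 : ℝ) (hw : w0 + w1 + w2 = 1) (hw2 : 0 < w2)
    (hfM : hf f (M *ᵥ f) = -(w0 * c 0 + w1 * c 1 + w2 * c 2)) :
    ∃ V : M3, memU21 V ∧ M = V * Matrix.diagonal c * V⁻¹ := by
  choose v hv0 hv using exists_eigvec hM hc htr hdet
  have horth : ∀ i j, i ≠ j → hf (v i) (v j) = 0 := fun i j hij =>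
    eig_orth hM (hc i) (fun h => hij (hinj h)) (hv i) (hv j)
  have hli : LinearIndependent ℂ v := by
    apply Module.End.eigenvectors_linearIndependent' (Matrix.toLin' M) c hinj v
    intro i
    refine ⟨?_, hv0 i⟩
    rw [Module.End.mem_eigenspace_iff, Matrix.toLin'_apply]
    exact hv i
  set V0 : M3 := (Matrix.of v)ᵀ with hV0
  have hV0u : IsUnit V0 := by
    rw [← Matrix.linearIndependent_cols_iff_isUnit]
    exact hli
  have hV0d : IsUnit V0.det := (Matrix.isUnit_iff_isUnit_det _).mp hV0u
  set t := V0⁻¹ *ᵥ f with ht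
  have hft : f = t 0 • v 0 + t 1 • v 1 + t 2 • v 2 := by
    have h1 : V0 *ᵥ t = f := by
      rw [ht, Matrix.mulVec_mulVec, Matrix.mul_nonsing_inv _ hV0d, Matrix.one_mulVec]
    rw [← h1]
    funext i
    simp [Matrix.mulVec, dotProduct, Fin.sum_univ_three, hV0, Matrix.of_apply]
    ring
  set n : Fin 3 → ℝ := fun k => ‖v k 0‖ ^ 2 + ‖v k 1‖ ^ 2 - ‖v k 2‖ ^ 2 with hn
  have hnk : ∀ k, hf (v k) (v k) = (n k : ℂ) := fun k => hf_self (v k)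
  have hexp : ∀ a b d : ℂ, hf f (a • v 0 + b • v 1 + d • v 2) =
      star (t 0) * a * n 0 + star (t 1) * b * n 1 + star (t 2) * d * n 2 := by
    intro a b d
    have h01 := horth 0 1 (by decide)
    have h02 := horth 0 2 (by decide)
    have h10 := horth 1 0 (by decide)
    have h12 := horth 1 2 (by decide)
    have h20 := horth 2 0 (by decide)
    have h21 := horth 2 1 (by decide)
    rw [← hnk, ← hnk, ← hnk, hft]
    simp only [hf, Pi.add_apply, Pi.smul_apply, smul_eq_mul, star_add, star_mul'] at *
    linear_combination star (t 0) * b * h01 + star (t 0) * d * h02 + star (t 1) * a * h10 +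
      star (t 1) * d * h12 + star (t 2) * a * h20 + star (t 2) * b * h21
  have hst : ∀ z : ℂ, star z * z = ((‖z‖ ^ 2 : ℝ) : ℂ) := by
    intro z
    rw [← Complex.normSq_eq_norm_sq, Complex.normSq_eq_conj_mul_self]; rfl
  have hff' := hexp (t 0) (t 1) (t 2)
  rw [← hft, hff, hst, hst, hst] at hff'
  have hMf : M *ᵥ f = (t 0 * c 0) • v 0 + (t 1 * c 1) • v 1 + (t 2 * c 2) • v 2 := by
    rw [hft]
    simp only [Matrix.mulVec_add, Matrix.mulVec_smul, hv, smul_smul]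
  have hfM' := hexp (t 0 * c 0) (t 1 * c 1) (t 2 * c 2)
  rw [← hMf, hfM, ← mul_assoc, ← mul_assoc, ← mul_assoc, hst, hst, hst] at hfM'
  have hr : ‖t 2‖ ^ 2 * n 2 + w2 = 0 := by
    refine bary_unique (hc 0) (hc 1) (hc 2) (hinj.ne (by decide)) (hinj.ne (by decide))
      (hinj.ne (by decide)) (p := ‖t 0‖ ^ 2 * n 0 + w0) (q := ‖t 1‖ ^ 2 * n 1 + w1) ?_ ?_
    · have : (-1 : ℝ) = ‖t 0‖ ^ 2 * n 0 + ‖t 1‖ ^ 2 * n 1 + ‖t 2‖ ^ 2 * n 2 := by exact_mod_cast hff'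
      linarith
    · push_cast at hfM' ⊢
      linear_combination -hfM'
  have hn2 : n 2 < 0 := by
    by_contra h
    push Not at h
    have := mul_nonneg (sq_nonneg ‖t 2‖) h
    linarith
  have hpos : ∀ k, k ≠ 2 → 0 < n k := by
    intro k hk
    exact pos_of_orth_neg (v k) (v 2) (hv0 k) hn2 (horth 2 k hk.symm)
  set d : Fin 3 → ℂ := fun k => ((1 / √|n k| : ℝ) : ℂ) with hd
  have hnne : ∀ k, n k ≠ 0 := by
    intro k
    by_cases hk : k = 2
    · rw [hk]; exact hn2.ne
    · exact (hpos k hk).ne'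
  have hd2 : ∀ k, d k * n k * d k = ((n k / |n k| : ℝ) : ℂ) := by
    intro k
    simp only [hd]
    rw [← Complex.ofReal_mul, ← Complex.ofReal_mul]
    congr 1
    have h1 : √|n k| ≠ 0 := (Real.sqrt_pos.mpr (abs_pos.mpr (hnne k))).ne'
    have h2 : √|n k| * √|n k| = |n k| := Real.mul_self_sqrt (abs_nonneg _)
    have h3 : |n k| ≠ 0 := (abs_pos.mpr (hnne k)).ne'
    field_simp
    rw [sq, h2, mul_comm]
  have hgram : V0ᴴ * J3 * V0 = Matrix.diagonal (fun k => (n k : ℂ)) := by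
    ext i j
    have h1 : (V0ᴴ * J3 * V0) i j = hf (v i) (v j) := by
      simp [hV0, J3, hf, Matrix.mul_apply, Fin.sum_univ_three, Matrix.diagonal_apply]
      ring
    rw [h1]
    by_cases hij : i = j
    · subst hij; simp [hnk]
    · simp [hij, horth i j hij]
  have hdstar : (Matrix.diagonal d)ᴴ = Matrix.diagonal d := by
    rw [Matrix.diagonal_conjTranspose]; congr 1; funext i; simp [hd]
  have hVU : memU21 (V0 * Matrix.diagonal d) := by
    unfold memU21
    rw [Matrix.conjTranspose_mul, hdstar]
    have : Matrix.diagonal d * V0ᴴ * J3 * (V0 * Matrix.diagonal d) =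
        Matrix.diagonal d * (V0ᴴ * J3 * V0) * Matrix.diagonal d := by noncomm_ring
    rw [this, hgram, Matrix.diagonal_mul_diagonal, Matrix.diagonal_mul_diagonal]
    unfold J3
    congr 1
    funext k
    rw [hd2]
    by_cases hk : k = 2
    · subst hk
      rw [abs_of_neg hn2, div_neg, div_self hn2.ne]; simp
    · rw [abs_of_pos (hpos k hk), div_self (hnne k)]
      fin_cases k
      · simp
      · simp
      · exact absurd rfl hk
  refine ⟨V0 * Matrix.diagonal d, hVU, ?_⟩
  have hMV0 : M * V0 = V0 * Matrix.diagonal c := by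
    ext i j
    have := congrFun (hv j) i
    rw [Matrix.mul_diagonal]
    simp only [Matrix.mulVec, dotProduct, Pi.smul_apply, smul_eq_mul] at this
    simp only [Matrix.mul_apply, hV0, Matrix.transpose_apply, Matrix.of_apply]
    rw [this, mul_comm]
  have hMV : M * (V0 * Matrix.diagonal d) = (V0 * Matrix.diagonal d) * Matrix.diagonal c := by
    rw [← Matrix.mul_assoc, hMV0, Matrix.mul_assoc, Matrix.mul_assoc,
      Matrix.diagonal_mul_diagonal, Matrix.diagonal_mul_diagonal]
    congr 2; funext i; ring
  rw [← hMV, Matrix.mul_assoc, Matrix.mul_nonsing_inv _ (memU21_isUnit hVU), Matrix.mul_one]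
/-! ### The explicit two-parameter family -/

/-- boost times rotation -/
def Pm (C S c s : ℝ) : M3 := !![(C : ℂ), -S, 0; c * S, c * C, s; s * S, s * C, c]

lemma memU21_Pm {C S c s : ℝ} (h1 : C ^ 2 + S ^ 2 = 1) (h2 : c ^ 2 - s ^ 2 = 1) :
    memU21 (Pm C S c s) := by
  have h1' : (C : ℂ) ^ 2 + S ^ 2 = 1 := by exact_mod_cast h1
  have h2' : (c : ℂ) ^ 2 - s ^ 2 = 1 := by exact_mod_cast h2
  unfold memU21
  ext i j
  fin_cases i <;> fin_cases j <;>
    simp [Pm, J3, Matrix.mul_apply, Fin.sum_univ_three, Matrix.diagonal_apply]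
  · linear_combination h1' + S ^ 2 * h2'
  · linear_combination C * S * h2'
  · ring
  · linear_combination C * S * h2'
  · linear_combination h1' + C ^ 2 * h2'
  · ring
  · ring
  · ring
  · linear_combination -h2'

lemma Pm_inv {C S c s : ℝ} (h1 : C ^ 2 + S ^ 2 = 1) (h2 : c ^ 2 - s ^ 2 = 1) :
    (Pm C S c s)⁻¹ = !![(C : ℂ), c * S, -(s * S); -S, c * C, -(s * C); 0, -s, c] := by
  rw [memU21_inv_eq (memU21_Pm h1 h2)]
  ext i j
  fin_cases i <;> fin_cases j <;>
    simp [Pm, J3, Matrix.mul_apply, Fin.sum_univ_three, Matrix.diagonal_apply]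

lemma core_lemma {a b c : Fin 3 → ℂ} (ha : ∀ i, ‖a i‖ = 1) (hb : ∀ i, ‖b i‖ = 1)
    (hc : ∀ i, ‖c i‖ = 1) (hinj : Function.Injective c)
    (hdet : a 0 * a 1 * a 2 * (b 0 * b 1 * b 2) = c 0 * c 1 * c 2)
    (x y : ℝ) (hx0 : 0 ≤ x) (hx1 : x ≤ 1) (hy : 0 ≤ y) (w0 w1 w2 : ℝ) (hw : w0 + w1 + w2 = 1)
    (hw2 : 0 < w2)
    (htr : a 0 * ((1 - x) * b 0 + x * b 1)
      + a 1 * ((1 + y) * (x * b 0 + (1 - x) * b 1) - y * b 2)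
      + a 2 * (-y * (x * b 0 + (1 - x) * b 1) + (1 + y) * b 2) = c 0 + c 1 + c 2)
    (hQ : b 2 * (a 2 + y * (a 2 - a 1)) = w0 * c 0 + w1 * c 1 + w2 * c 2) :
    ∃ P V : M3, memU21 P ∧ memU21 V ∧
      Matrix.diagonal a * (P * Matrix.diagonal b * P⁻¹) = V * Matrix.diagonal c * V⁻¹ := by
  obtain ⟨C, hC⟩ : ∃ C : ℝ, C ^ 2 = 1 - x := ⟨√(1 - x), Real.sq_sqrt (by linarith)⟩
  obtain ⟨S, hS⟩ : ∃ S : ℝ, S ^ 2 = x := ⟨√x, Real.sq_sqrt hx0⟩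
  obtain ⟨k, hk⟩ : ∃ k : ℝ, k ^ 2 = 1 + y := ⟨√(1 + y), Real.sq_sqrt (by linarith)⟩
  obtain ⟨s, hs⟩ : ∃ s : ℝ, s ^ 2 = y := ⟨√y, Real.sq_sqrt hy⟩
  have h1 : C ^ 2 + S ^ 2 = 1 := by linarith
  have h2 : k ^ 2 - s ^ 2 = 1 := by linarith
  have hP := memU21_Pm h1 h2
  have hM : memU21 (Matrix.diagonal a * (Pm C S k s * Matrix.diagonal b * (Pm C S k s)⁻¹)) :=
    memU21_mul (memU21_diag ha) (memU21_mul (memU21_mul hP (memU21_diag hb)) (memU21_inv hP))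
  have hC' : (C : ℂ) ^ 2 = 1 - x := by exact_mod_cast hC
  have hS' : (S : ℂ) ^ 2 = x := by exact_mod_cast hS
  have hk' : (k : ℂ) ^ 2 = 1 + y := by exact_mod_cast hk
  have hs' : (s : ℂ) ^ 2 = y := by exact_mod_cast hs
  refine ⟨Pm C S k s, ?_⟩
  have hdet' : (Matrix.diagonal a * (Pm C S k s * Matrix.diagonal b * (Pm C S k s)⁻¹)).det
      = c 0 * c 1 * c 2 := by
    rw [← hdet, Matrix.det_mul, Matrix.det_conj (memU21_isUnit hP |> (Matrix.isUnit_iff_isUnit_det _).mpr)]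
    simp [Matrix.det_diagonal, Fin.prod_univ_three]
  have htr' : (Matrix.diagonal a * (Pm C S k s * Matrix.diagonal b * (Pm C S k s)⁻¹)).trace
      = c 0 + c 1 + c 2 := by
    rw [← htr, Pm_inv h1 h2, ← hs', ← hS']
    have e1 : (1 : ℂ) - (S : ℂ) ^ 2 = C ^ 2 := by rw [hC', hS']
    have e2 : (1 : ℂ) + (s : ℂ) ^ 2 = k ^ 2 := by rw [hk', hs']
    rw [e1, e2]
    simp [Pm, Matrix.trace_fin_three, Matrix.mul_apply, Fin.sum_univ_three, Matrix.diagonal_apply,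
      Matrix.vecMul, dotProduct]
    ring
  have hMf : (Matrix.diagonal a * (Pm C S k s * Matrix.diagonal b * (Pm C S k s)⁻¹)) *ᵥ
      ![0, (s : ℂ), k] = ![0, a 1 * b 2 * s, a 2 * b 2 * k] := by
    have hf0 : ![0, (s : ℂ), k] = Pm C S k s *ᵥ ![0, 0, 1] := by
      funext i; fin_cases i <;> simp [Pm, Matrix.mulVec, dotProduct, Fin.sum_univ_three]
    rw [hf0, Matrix.mulVec_mulVec, Matrix.mul_assoc, Matrix.mul_assoc _ _ (Pm C S k s),
      Matrix.nonsing_inv_mul _ (memU21_isUnit hP), Matrix.mul_one]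
    funext i
    fin_cases i <;>
    simp [Pm, Matrix.mul_apply, Matrix.mulVec, dotProduct, Fin.sum_univ_three,
      Matrix.vecMul_diagonal]
    · ring
    · ring
  obtain ⟨V, hV, hV2⟩ := diag_lemma hM hc hinj htr' hdet' ![0, (s : ℂ), k]
    (by simp [hf]; linear_combination hs' - hk') w0 w1 w2 hw hw2
    (by
      rw [hMf]; simp [hf]
      linear_combination a 1 * b 2 * hs' - a 2 * b 2 * hk' - hQ)
  exact ⟨V, hP, hV, hV2⟩
/-! ### Algebra of the trace equation -/

lemma conj_unit {z : ℂ} (h : ‖z‖ = 1) : (starRingEnd ℂ) z = z⁻¹ := (Complex.inv_eq_conj h).symm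

lemma ne_zero_unit {z : ℂ} (h : ‖z‖ = 1) : z ≠ 0 := by
  intro h0; rw [h0] at h; simp at h

lemma trace_of_R {a1 a2 b1 b2 D T Q R : ℂ} (ha1 : ‖a1‖ = 1) (ha2 : ‖a2‖ = 1)
    (hb1 : ‖b1‖ = 1) (hb2 : ‖b2‖ = 1) (hD : D = a1 * a2 * b1 * b2) (hb : b1 ≠ b2) (y : ℝ)
    (hQ : Q = 1 + y * (1 - a2)) (hR : ‖R‖ ≤ 1)
    (hline : R + a1 * b1 * (a1 * b2) * (starRingEnd ℂ) R = a1 * b1 + a1 * b2)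
    (hT : T = Q + R + D * (starRingEnd ℂ) Q * (starRingEnd ℂ) R) :
    ∃ x : ℝ, 0 ≤ x ∧ x ≤ 1 ∧
      a1 * ((1 - x) * b1 + x * b2) + a2 * ((1 + y) * (x * b1 + (1 - x) * b2) - y * 1)
      + 1 * (-y * (x * b1 + (1 - x) * b2) + (1 + y) * 1) = T := by
  have na1 := ne_zero_unit ha1
  have na2 := ne_zero_unit ha2
  have nb1 := ne_zero_unit hb1
  have nb2 := ne_zero_unit hb2
  have nb : b2 - b1 ≠ 0 := sub_ne_zero.mpr hb.symm
  have nb' : b1 - b2 ≠ 0 := sub_ne_zero.mpr hb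
  have hRc : (starRingEnd ℂ) R = (a1 * b1 + a1 * b2 - R) / (a1 * b1 * (a1 * b2)) := by
    rw [eq_div_iff (by simp [na1, nb1, nb2])]
    linear_combination hline
  obtain ⟨x, hx⟩ : ∃ x : ℝ, (x : ℂ) = (R - a1 * b1) / (a1 * b2 - a1 * b1) := by
    have h : (starRingEnd ℂ) ((R - a1 * b1) / (a1 * b2 - a1 * b1)) =
        (R - a1 * b1) / (a1 * b2 - a1 * b1) := by
      simp only [map_div₀, map_sub, map_mul, conj_unit ha1, conj_unit hb1, conj_unit hb2, hRc]
      have e1 : a1 * b2 - a1 * b1 ≠ 0 := by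
        rw [← mul_sub]; exact mul_ne_zero na1 nb
      have e2 : a1⁻¹ * b2⁻¹ - a1⁻¹ * b1⁻¹ = (b1 - b2) / (a1 * b1 * b2) := by
        field_simp
      rw [e2]
      rw [← mul_sub] at e1 ⊢
      field_simp
      ring
    obtain ⟨r, hr⟩ := Complex.conj_eq_iff_real.mp h
    exact ⟨r, hr.symm⟩
  have hRx : R = (1 - x) * (a1 * b1) + x * (a1 * b2) := by
    rw [eq_div_iff (by rw [← mul_sub]; exact mul_ne_zero na1 nb)] at hx
    linear_combination -hx
  have hRb : (starRingEnd ℂ) R = (1 - x) * (a1⁻¹ * b1⁻¹) + x * (a1⁻¹ * b2⁻¹) := by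
    rw [hRx]
    simp only [map_add, map_sub, map_mul, conj_unit ha1, conj_unit hb1, conj_unit hb2, map_one,
      Complex.conj_ofReal]
  have hnb : (Complex.normSq (b1 - b2) : ℂ) = 2 - b1 / b2 - b2 / b1 := by
    rw [← Complex.mul_conj, map_sub, conj_unit hb1, conj_unit hb2]
    field_simp
    ring
  have hn : Complex.normSq R = 1 - x * (1 - x) * Complex.normSq (b1 - b2) := by
    have : (Complex.normSq R : ℂ) = ((1 - x * (1 - x) * Complex.normSq (b1 - b2) : ℝ) : ℂ) := by
      push_cast
      rw [hnb, ← Complex.mul_conj, hRb, hRx]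
      field_simp
      ring
    exact_mod_cast this
  have hn1 : Complex.normSq R ≤ 1 := by
    rw [Complex.normSq_eq_norm_sq]
    have := norm_nonneg R
    nlinarith
  have hpos : 0 < Complex.normSq (b1 - b2) := Complex.normSq_pos.mpr nb'
  have hxx : 0 ≤ x * (1 - x) := by
    by_contra h
    push Not at h
    have := mul_neg_of_neg_of_pos h hpos
    linarith
  refine ⟨x, ?_, ?_, ?_⟩
  · nlinarith
  · nlinarith
  · rw [hT, hRb, hD, hQ, hRx]
    simp only [map_add, map_sub, map_mul, conj_unit ha2, map_one, Complex.conj_ofReal]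
    field_simp
    ring

lemma iso_lemma {a1 a2 b1 b2 c1 c2 c3 : ℂ} (ha1 : ‖a1‖ = 1) (ha2 : ‖a2‖ = 1)
    (hb1 : ‖b1‖ = 1) (hb2 : ‖b2‖ = 1) (hc1 : ‖c1‖ = 1) (hc2 : ‖c2‖ = 1) (hc3 : ‖c3‖ = 1)
    (hD : a1 * a2 * b1 * b2 = c1 * c2 * c3) (hb : b1 ≠ b2) (y w1 w2 w3 L1 L2 L3 : ℝ)
    (hw : w1 + w2 + w3 = 1) (hw1 : w1 ≤ 0) (hw2 : w2 ≤ 0)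
    (hL1 : (L1 : ℂ) = 2 - c2 / c3 - c3 / c2) (hL2 : (L2 : ℂ) = 2 - c1 / c3 - c3 / c1)
    (hL3 : (L3 : ℂ) = 2 - c1 / c2 - c2 / c1) (hL1' : 0 ≤ L1) (hL2' : 0 ≤ L2) (hL3' : 0 ≤ L3)
    (hQ : 1 + y * (1 - a2) = w1 * c1 + w2 * c2 + w3 * c3)
    (hden : w2 * w3 * L1 + w1 * w3 * L2 + w1 * w2 * L3 ≠ 0)
    (hline : w2 * w3 * L1 * (c1 + a1 * b1 * (a1 * b2) / c1 - a1 * b1 - a1 * b2) +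
      w1 * w3 * L2 * (c2 + a1 * b1 * (a1 * b2) / c2 - a1 * b1 - a1 * b2) +
      w1 * w2 * L3 * (c3 + a1 * b1 * (a1 * b2) / c3 - a1 * b1 - a1 * b2) = 0) :
    ∃ x : ℝ, 0 ≤ x ∧ x ≤ 1 ∧
      a1 * ((1 - x) * b1 + x * b2) + a2 * ((1 + y) * (x * b1 + (1 - x) * b2) - y * 1)
      + 1 * (-y * (x * b1 + (1 - x) * b2) + (1 + y) * 1) = c1 + c2 + c3 := by
  have nc1 := ne_zero_unit hc1
  have nc2 := ne_zero_unit hc2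
  have nc3 := ne_zero_unit hc3
  set den : ℝ := w2 * w3 * L1 + w1 * w3 * L2 + w1 * w2 * L3 with hdeneq
  set N : ℂ := w2 * w3 * L1 * c1 + w1 * w3 * L2 * c2 + w1 * w2 * L3 * c3 with hN
  have hden' : (den : ℂ) ≠ 0 := by exact_mod_cast hden
  have hNc : (starRingEnd ℂ) N = w2 * w3 * L1 / c1 + w1 * w3 * L2 / c2 + w1 * w2 * L3 / c3 := by
    rw [hN]
    simp only [map_add, map_mul, conj_unit hc1, conj_unit hc2, conj_unit hc3, Complex.conj_ofReal]
    simp only [div_eq_mul_inv]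
  have hdenC : (den : ℂ) = w2 * w3 * L1 + w1 * w3 * L2 + w1 * w2 * L3 := by
    rw [hdeneq]; push_cast; ring
  have hw3 : (w3 : ℂ) = 1 - w1 - w2 := by
    have : w3 = 1 - w1 - w2 := by linarith
    rw [this]; push_cast; ring
  have hw3' : 0 < w3 := by linarith
  apply trace_of_R (R := N / den) (Q := 1 + y * (1 - a2)) ha1 ha2 hb1 hb2 hD.symm hb y rfl
  · have h1 : den ^ 2 - Complex.normSq N = w1 * w2 * w3 * L1 * L2 * L3 := by
      have : (den : ℂ) ^ 2 - (Complex.normSq N : ℂ) = w1 * w2 * w3 * L1 * L2 * L3 := by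
        rw [← Complex.mul_conj, hNc, hN, hdenC, hL1, hL2, hL3, hw3]
        field_simp
        ring
      exact_mod_cast this
    have h2 : 0 ≤ w1 * w2 * w3 * L1 * L2 * L3 := by
      have : 0 ≤ w1 * w2 := mul_nonneg_of_nonpos_of_nonpos hw1 hw2
      positivity
    have h3 : ‖N‖ ^ 2 ≤ |den| ^ 2 := by
      rw [sq_abs, ← Complex.normSq_eq_norm_sq]; linarith
    rw [norm_div, Complex.norm_real, Real.norm_eq_abs]
    exact div_le_one_of_le₀ (abs_le_of_sq_le_sq' h3 (abs_nonneg _)).2 (abs_nonneg _)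
  · rw [map_div₀, Complex.conj_ofReal, hNc]
    rw [mul_div_assoc', ← add_div, div_eq_iff hden', hdenC, hN]
    linear_combination hline
  · rw [hQ, map_div₀, Complex.conj_ofReal, hNc]
    simp only [map_add, map_mul, conj_unit hc1, conj_unit hc2, conj_unit hc3, Complex.conj_ofReal]
    rw [mul_div_assoc']
    have : ∀ q : ℂ, q + N / den = (q * den + N) / den := by intro q; field_simp
    rw [this, ← add_div, eq_div_iff hden', hdenC, hN, hL1, hL2, hL3, hw3]
    field_simp
    ring
/-! ### Solutions of the multiplicative problem, in complex form -/

/-- diag(a₁,a₂,1) -/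
def Ec (a1 a2 : ℂ) : M3 := Matrix.diagonal ![a1, a2, 1]

/-- there is a solution of the product problem with these eigenvalues and scalar `u` -/
def VC (a1 a2 b1 b2 g1 g2 u : ℂ) : Prop := ∃ P1 P2 P3 : M3, memU21 P1 ∧ memU21 P2 ∧ memU21 P3 ∧
  (P1 * Ec a1 a2 * P1⁻¹) * (P2 * Ec b1 b2 * P2⁻¹) * (P3 * Ec g1 g2 * P3⁻¹) = u • (1 : M3)

lemma VC_of_trace {a1 a2 b1 b2 g1 g2 c1 c2 c3 : ℂ} (ha1 : ‖a1‖ = 1) (ha2 : ‖a2‖ = 1)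
    (hb1 : ‖b1‖ = 1) (hb2 : ‖b2‖ = 1) (hc1 : ‖c1‖ = 1) (hc2 : ‖c2‖ = 1) (hc3 : ‖c3‖ = 1)
    (h12 : c1 ≠ c2) (h13 : c1 ≠ c3) (h23 : c2 ≠ c3)
    (hg1 : c1 * g1 = c3) (hg2 : c2 * g2 = c3)
    (hD : a1 * a2 * b1 * b2 = c1 * c2 * c3) (y w1 w2 w3 : ℝ) (hy : 0 ≤ y)
    (hw : w1 + w2 + w3 = 1) (hw3 : 0 < w3)
    (hQ : 1 + y * (1 - a2) = w1 * c1 + w2 * c2 + w3 * c3)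
    (hx : ∃ x : ℝ, 0 ≤ x ∧ x ≤ 1 ∧
      a1 * ((1 - x) * b1 + x * b2) + a2 * ((1 + y) * (x * b1 + (1 - x) * b2) - y * 1)
      + 1 * (-y * (x * b1 + (1 - x) * b2) + (1 + y) * 1) = c1 + c2 + c3) :
    VC a1 a2 b1 b2 g1 g2 c3 := by
  obtain ⟨x, hx0, hx1, htr⟩ := hx
  obtain ⟨P, V, hP, hV, h⟩ := core_lemma (a := ![a1, a2, 1]) (b := ![b1, b2, 1])
    (c := ![c1, c2, c3])
    (by intro i; fin_cases i <;> simp [ha1, ha2]) (by intro i; fin_cases i <;> simp [hb1, hb2])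
    (by intro i; fin_cases i <;> simp [hc1, hc2, hc3])
    (by
      intro i j hij
      fin_cases i <;> fin_cases j <;> simp at hij ⊢ <;>
      first | exact h12 hij | exact h13 hij | exact h23 hij | exact h12 hij.symm
            | exact h13 hij.symm | exact h23 hij.symm)
    (by simp; linear_combination hD) x y hx0 hx1 hy w1 w2 w3 hw hw3 (by simpa using htr)
    (by simpa using hQ)
  refine ⟨1, P, V, memU21_one, hP, hV, ?_⟩
  have hVu := memU21_isUnit hV
  unfold Ec
  rw [inv_one, Matrix.one_mul, Matrix.mul_one, h]
  have h1 : V * diagonal ![c1, c2, c3] * V⁻¹ * (V * diagonal ![g1, g2, 1] * V⁻¹) =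
      V * diagonal ![c1, c2, c3] * (V⁻¹ * V) * diagonal ![g1, g2, 1] * V⁻¹ := by
    noncomm_ring
  rw [h1, Matrix.nonsing_inv_mul _ hVu, Matrix.mul_one, Matrix.mul_assoc V,
    Matrix.diagonal_mul_diagonal]
  have h2 : (fun i => ![c1, c2, c3] i * ![g1, g2, 1] i) = fun _ => c3 := by
    funext i; fin_cases i <;> simp [hg1, hg2]
  rw [h2, ← Matrix.smul_one_eq_diagonal, Matrix.mul_smul, Matrix.mul_one, Matrix.smul_mul,
    Matrix.mul_nonsing_inv _ hVu]

lemma VC_of_root {a1 a2 b1 b2 g1 g2 c1 c2 c3 ρ : ℂ} (ha1 : ‖a1‖ = 1) (ha2 : ‖a2‖ = 1)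
    (hb1 : ‖b1‖ = 1) (hb2 : ‖b2‖ = 1) (hc1 : ‖c1‖ = 1) (hc2 : ‖c2‖ = 1) (hc3 : ‖c3‖ = 1)
    (h12 : c1 ≠ c2) (h13 : c1 ≠ c3) (h23 : c2 ≠ c3)
    (hg1 : c1 * g1 = c3) (hg2 : c2 * g2 = c3)
    (hD : a1 * a2 * b1 * b2 = c1 * c2 * c3) (hb : b1 ≠ b2) (y w1 w2 w3 L1 L2 L3 G1 G2 G3 K : ℝ)
    (hw : w1 + w2 + w3 = 1) (hw1 : w1 ≤ 0) (hw2 : w2 ≤ 0)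
    (hL1 : (L1 : ℂ) = 2 - c2 / c3 - c3 / c2) (hL2 : (L2 : ℂ) = 2 - c1 / c3 - c3 / c1)
    (hL3 : (L3 : ℂ) = 2 - c1 / c2 - c2 / c1) (hL1' : 0 ≤ L1) (hL2' : 0 ≤ L2) (hL3' : 0 ≤ L3)
    (hK : (K : ℂ) = 2 - a2 - 1 / a2) (hK' : 0 < K)
    (hQ : 1 + y * (1 - a2) = w1 * c1 + w2 * c2 + w3 * c3) (hy : 0 < y)
    (hG1 : c1 + a1 * b1 * (a1 * b2) / c1 - a1 * b1 - a1 * b2 = ρ * G1)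
    (hG2 : c2 + a1 * b1 * (a1 * b2) / c2 - a1 * b1 - a1 * b2 = ρ * G2)
    (hG3 : c3 + a1 * b1 * (a1 * b2) / c3 - a1 * b1 - a1 * b2 = ρ * G3)
    (hG : w2 * w3 * L1 * G1 + w1 * w3 * L2 * G2 + w1 * w2 * L3 * G3 = 0) :
    VC a1 a2 b1 b2 g1 g2 c3 := by
  have nc1 := ne_zero_unit hc1
  have nc2 := ne_zero_unit hc2
  have nc3 := ne_zero_unit hc3
  have na2 := ne_zero_unit ha2
  have hw3 : (w3 : ℂ) = 1 - w1 - w2 := by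
    have : w3 = 1 - w1 - w2 := by linarith
    rw [this]; push_cast; ring
  have hG' : (w2 : ℂ) * w3 * L1 * G1 + w1 * w3 * L2 * G2 + w1 * w2 * L3 * G3 = 0 := by
    exact_mod_cast hG
  refine VC_of_trace ha1 ha2 hb1 hb2 hc1 hc2 hc3 h12 h13 h23 hg1 hg2 hD y w1 w2 w3 hy.le hw
    (by linarith) hQ ?_
  refine iso_lemma ha1 ha2 hb1 hb2 hc1 hc2 hc3 hD hb y w1 w2 w3 L1 L2 L3 hw hw1 hw2 hL1 hL2 hL3
    hL1' hL2' hL3' hQ ?_ ?_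
  · have h1 : w2 * w3 * L1 + w1 * w3 * L2 + w1 * w2 * L3 = -(y * (1 + y) * K) := by
      have hQc : 1 + y * (1 - 1 / a2) = w1 / c1 + w2 / c2 + w3 / c3 := by
        have := congrArg (starRingEnd ℂ) hQ
        simp only [map_add, map_sub, map_one, map_mul, conj_unit hc1, conj_unit hc2, conj_unit hc3,
          conj_unit ha2, Complex.conj_ofReal] at this
        simpa [div_eq_mul_inv] using this
      have h2 : (w2 : ℂ) * w3 * L1 + w1 * w3 * L2 + w1 * w2 * L3 =
          1 - (w1 * c1 + w2 * c2 + w3 * c3) * (w1 / c1 + w2 / c2 + w3 / c3) := by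
        rw [hL1, hL2, hL3, hw3]
        field_simp
        ring
      rw [← hQ, ← hQc] at h2
      have h3 : (w2 : ℂ) * w3 * L1 + w1 * w3 * L2 + w1 * w2 * L3 = -(y * (1 + y) * K) := by
        rw [h2, hK]
        field_simp
        ring
      exact_mod_cast h3
    rw [h1]
    have : 0 < y * (1 + y) * K := by positivity
    linarith
  · rw [hG1, hG2, hG3]
    linear_combination ρ * hG'

/-- reducible case, two chords of the unit circle crossing -/
lemma VC_cross {a1 a2 b1 b2 g1 g2 c1 c2 ρ : ℂ} (ha1 : ‖a1‖ = 1) (ha2 : ‖a2‖ = 1)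
    (hb1 : ‖b1‖ = 1) (hb2 : ‖b2‖ = 1) (hc1 : ‖c1‖ = 1) (hc2 : ‖c2‖ = 1)
    (h12 : c1 ≠ c2) (h13 : c1 ≠ 1) (h23 : c2 ≠ 1)
    (hg1 : c1 * g1 = 1) (hg2 : c2 * g2 = 1)
    (hD : a1 * a2 * b1 * b2 = c1 * c2 * 1) (hb : b1 ≠ b2) (G1 G2 : ℝ)
    (hG1 : c1 + a1 * b1 * (a1 * b2) / c1 - a1 * b1 - a1 * b2 = ρ * G1)
    (hG2 : c2 + a1 * b1 * (a1 * b2) / c2 - a1 * b1 - a1 * b2 = ρ * G2)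
    (h1 : 0 ≤ G1) (h2 : G2 ≤ 0) : VC a1 a2 b1 b2 g1 g2 1 := by
  have nc1 := ne_zero_unit hc1
  have nc2 := ne_zero_unit hc2
  obtain ⟨t, ht0, ht1, ht⟩ : ∃ t : ℝ, 0 ≤ t ∧ t ≤ 1 ∧ (1 - t) * G1 + t * G2 = 0 := by
    rcases eq_or_lt_of_le h1 with h | h
    · exact ⟨0, le_rfl, zero_le_one, by rw [← h]; ring⟩
    · have hp : 0 < G1 - G2 := by linarith
      refine ⟨G1 / (G1 - G2), by positivity, ?_, ?_⟩
      · rw [div_le_one hp]; linarith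
      · field_simp; ring
  have ht' : (1 - (t : ℂ)) * G1 + t * G2 = 0 := by exact_mod_cast ht
  set R : ℂ := (1 - t) * c1 + t * c2 with hR
  have hRc : (starRingEnd ℂ) R = (1 - t) / c1 + t / c2 := by
    rw [hR]
    simp only [map_add, map_sub, map_mul, conj_unit hc1, conj_unit hc2, map_one,
      Complex.conj_ofReal, div_eq_mul_inv]
  refine VC_of_trace ha1 ha2 hb1 hb2 hc1 hc2 (by simp) h12 h13 h23 hg1 hg2 hD 0 0 0 1 le_rfl
    (by norm_num) (by norm_num) (by simp) ?_
  apply trace_of_R (R := R) (Q := 1 + (0 : ℝ) * (1 - a2)) ha1 ha2 hb1 hb2 hD.symm hb 0 rfl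
  · calc ‖R‖ ≤ ‖(1 - (t : ℂ)) * c1‖ + ‖(t : ℂ) * c2‖ := norm_add_le _ _
      _ = 1 := by
        rw [norm_mul, norm_mul, hc1, hc2]
        have e1 : (1 - (t : ℂ)) = ((1 - t : ℝ) : ℂ) := by push_cast; ring
        rw [e1, Complex.norm_real, Complex.norm_real, Real.norm_of_nonneg ht0,
          Real.norm_of_nonneg (by linarith)]
        ring
  · rw [hRc, hR]
    linear_combination (1 - (t : ℂ)) * hG1 + t * hG2 + ρ * ht'
  · rw [hRc, hR]
    simp
    field_simp
    ring
/-! ### Existence of the root -/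

lemma quad_large (A B C y1 : ℝ) (hA : 0 < A) : ∃ Y, y1 ≤ Y ∧ 0 ≤ A * Y ^ 2 + B * Y + C := by
  set Z := max y1 ((|B| + |C|) / A + 1) with hZ
  have h1 : y1 ≤ Z := le_max_left _ _
  have h2 : (|B| + |C|) / A + 1 ≤ Z := le_max_right _ _
  refine ⟨Z, h1, ?_⟩
  have h3 : 0 ≤ (|B| + |C|) / A := by positivity
  have h4 : 1 ≤ Z := by linarith
  have h5 : |B| + |C| ≤ A * Z := by
    have : (|B| + |C|) / A ≤ Z := by linarith
    rw [div_le_iff₀ hA] at this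
    linarith
  have h6 : (|B| + |C|) * Z ≤ A * Z * Z := mul_le_mul_of_nonneg_right h5 (by linarith)
  have h7 : |C| * 1 ≤ |C| * Z := mul_le_mul_of_nonneg_left h4 (abs_nonneg _)
  have h8 : -|B| * Z ≤ B * Z := mul_le_mul_of_nonneg_right (neg_abs_le B) (by linarith)
  have h9 := neg_abs_le C
  nlinarith

/-- the quadratic function whose root is wanted -/
def FF (s1 s2 t1 t2 E1 E2 E3 y : ℝ) : ℝ :=
  (s2 + y * t2) * (1 - (s1 + y * t1) - (s2 + y * t2)) * E1 +
  (s1 + y * t1) * (1 - (s1 + y * t1) - (s2 + y * t2)) * E2 +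
  (s1 + y * t1) * (s2 + y * t2) * E3

lemma FF_cont (s1 s2 t1 t2 E1 E2 E3 : ℝ) : Continuous (FF s1 s2 t1 t2 E1 E2 E3) := by
  unfold FF; fun_prop

lemma root_exists (s1 s2 t1 t2 E1 E2 E3 : ℝ) (hs1 : 0 < s1) (ht1 : t1 < 0)
    (hdet : 0 ≤ s2 * t1 - s1 * t2) (hE1 : 0 ≤ E1) (hcase : E2 ≤ 0 ∨ t2 ≤ 0)
    (hlead : 0 < t2 * (-t1 - t2) * E1 + t1 * (-t1 - t2) * E2 + t1 * t2 * E3) :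
    ∃ y, 0 < y ∧ s1 + y * t1 ≤ 0 ∧ s2 + y * t2 ≤ 0 ∧ FF s1 s2 t1 t2 E1 E2 E3 y = 0 := by
  set y1 := s1 / (-t1) with hy1
  have hy1p : 0 < y1 := div_pos hs1 (by linarith)
  have hw1 : s1 + y1 * t1 = 0 := by
    rw [hy1, div_mul_eq_mul_div, div_neg, mul_div_assoc, div_self ht1.ne]; ring
  have hw2 : s2 + y1 * t2 ≤ 0 := by
    have : (s2 + y1 * t2) * t1 = s2 * t1 - s1 * t2 := by
      linear_combination t2 * hw1
    by_contra h
    push Not at h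
    have := mul_neg_of_pos_of_neg h ht1
    linarith
  have hF1 : FF s1 s2 t1 t2 E1 E2 E3 y1 ≤ 0 := by
    unfold FF
    rw [hw1]
    have : 0 ≤ (-(s2 + y1 * t2)) * (1 - (s2 + y1 * t2)) * E1 := by
      apply mul_nonneg (mul_nonneg _ _) hE1 <;> linarith
    linarith
  have key : ∃ Y, y1 ≤ Y ∧ 0 ≤ FF s1 s2 t1 t2 E1 E2 E3 Y ∧ ∀ y, y1 ≤ y → y ≤ Y →
      s2 + y * t2 ≤ 0 := by
    rcases le_or_gt t2 0 with h | h
    · obtain ⟨Y, hY, hY2⟩ := quad_large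
        (t2 * (-t1 - t2) * E1 + t1 * (-t1 - t2) * E2 + t1 * t2 * E3)
        (s2 * (-t1 - t2) * E1 + t2 * (1 - s1 - s2) * E1 + s1 * (-t1 - t2) * E2 +
          t1 * (1 - s1 - s2) * E2 + s1 * t2 * E3 + t1 * s2 * E3)
        (s2 * (1 - s1 - s2) * E1 + s1 * (1 - s1 - s2) * E2 + s1 * s2 * E3) y1 hlead
      refine ⟨Y, hY, ?_, ?_⟩
      · unfold FF; linarith
      · intro y hy _
        have : y * t2 ≤ y1 * t2 := mul_le_mul_of_nonpos_right hy h
        linarith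
    · have hE2 : E2 ≤ 0 := by
        rcases hcase with h' | h'
        · exact h'
        · linarith
      have hY : s2 + (-s2 / t2) * t2 = 0 := by field_simp; ring
      have hYy : y1 ≤ -s2 / t2 := by
        rw [le_div_iff₀ h]; linarith
      refine ⟨-s2 / t2, hYy, ?_, ?_⟩
      · unfold FF
        rw [hY]
        have h2 : s1 + -s2 / t2 * t1 ≤ 0 := by
          have := mul_le_mul_of_nonpos_right hYy ht1.le
          linarith
        have : 0 ≤ (-(s1 + -s2 / t2 * t1)) * (1 - (s1 + -s2 / t2 * t1)) * (-E2) := by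
          apply mul_nonneg (mul_nonneg _ _) _ <;> linarith
        linarith
      · intro y _ hy
        have := mul_le_mul_of_nonneg_right hy h.le
        linarith
  obtain ⟨Y, hY, hFY, hYw⟩ := key
  obtain ⟨y, ⟨hya, hyb⟩, hy⟩ := intermediate_value_Icc hY
    (FF_cont s1 s2 t1 t2 E1 E2 E3).continuousOn ⟨hF1, hFY⟩
  refine ⟨y, by linarith, ?_, hYw y hya hyb, hy⟩
  have := mul_le_mul_of_nonpos_right hya ht1.le
  linarith

lemma root_exists_zero (t1 t2 E1 E2 E3 : ℝ) (ht1 : t1 < 0) (ht2 : t2 < 0)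
    (hE1 : 0 ≤ E1) (hE2 : 0 < E2)
    (hlead : 0 < t2 * (-t1 - t2) * E1 + t1 * (-t1 - t2) * E2 + t1 * t2 * E3) :
    ∃ y, 0 < y ∧ 0 + y * t1 ≤ 0 ∧ 0 + y * t2 ≤ 0 ∧ FF 0 0 t1 t2 E1 E2 E3 y = 0 := by
  set A := t2 * (-t1 - t2) * E1 + t1 * (-t1 - t2) * E2 + t1 * t2 * E3 with hA
  set B := -(t2 * E1 + t1 * E2) with hB
  have hBp : 0 < B := by
    have := mul_neg_of_neg_of_pos ht1 hE2
    have := mul_nonneg (neg_nonneg.mpr ht2.le) hE1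
    rw [hB]; linarith
  have hy : 0 < B / A := div_pos hBp hlead
  refine ⟨B / A, hy, ?_, ?_, ?_⟩
  · have := mul_neg_of_pos_of_neg hy ht1
    linarith
  · have := mul_neg_of_pos_of_neg hy ht2
    linarith
  · have h1 : FF 0 0 t1 t2 E1 E2 E3 (B / A) = (B / A) * ((B / A) * A - B) := by
      unfold FF; rw [hB, hA]; ring
    rw [h1, div_mul_cancel₀ _ hlead.ne']; ring

lemma lead_lemma {a1 a2 b1 b2 c1 c2 c3 ρ : ℂ} (na1 : a1 ≠ 0) (na2 : a2 ≠ 0)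
    (nb1 : b1 ≠ 0) (nb2 : b2 ≠ 0) (hc1 : ‖c1‖ = 1) (hc2 : ‖c2‖ = 1) (hc3 : ‖c3‖ = 1)
    (ha2 : ‖a2‖ = 1) (hρ : ρ ≠ 0)
    (hD : a1 * a2 * b1 * b2 = c1 * c2 * c3) (t1 t2 L1 L2 L3 G1 G2 G3 K GK : ℝ)
    (hL1 : (L1 : ℂ) = 2 - c2 / c3 - c3 / c2) (hL2 : (L2 : ℂ) = 2 - c1 / c3 - c3 / c1)
    (hL3 : (L3 : ℂ) = 2 - c1 / c2 - c2 / c1)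
    (hK : (K : ℂ) = 2 - a2 - 1 / a2)
    (hG1 : c1 + a1 * b1 * (a1 * b2) / c1 - a1 * b1 - a1 * b2 = ρ * G1)
    (hG2 : c2 + a1 * b1 * (a1 * b2) / c2 - a1 * b1 - a1 * b2 = ρ * G2)
    (hG3 : c3 + a1 * b1 * (a1 * b2) / c3 - a1 * b1 - a1 * b2 = ρ * G3)
    (hGK : a1 * (1 - b1) * (1 - b2) = ρ * GK)
    (ht : 1 - a2 = t1 * (c1 - c3) + t2 * (c2 - c3)) :
    t2 * (-t1 - t2) * (L1 * G1) + t1 * (-t1 - t2) * (L2 * G2) + t1 * t2 * (L3 * G3) = -K * GK := by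
  have nc1 := ne_zero_unit hc1
  have nc2 := ne_zero_unit hc2
  have nc3 := ne_zero_unit hc3
  have htc : 1 - 1 / a2 = t1 * (1 / c1 - 1 / c3) + t2 * (1 / c2 - 1 / c3) := by
    have := congrArg (starRingEnd ℂ) ht
    simp only [map_add, map_sub, map_one, map_mul, conj_unit hc1, conj_unit hc2, conj_unit hc3,
      conj_unit ha2, Complex.conj_ofReal] at this
    simpa [div_eq_mul_inv] using this
  have e1 : (t2 : ℂ) * (-t1 - t2) * L1 * c1 + t1 * (-t1 - t2) * L2 * c2 + t1 * t2 * L3 * c3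
      = c1 * c2 * c3 * (1 - 1 / a2) ^ 2 := by
    rw [htc, hL1, hL2, hL3]; field_simp; ring
  have e2 : (t2 : ℂ) * (-t1 - t2) * L1 / c1 + t1 * (-t1 - t2) * L2 / c2 + t1 * t2 * L3 / c3
      = (1 - a2) ^ 2 / (c1 * c2 * c3) := by
    rw [ht, hL1, hL2, hL3]; field_simp; ring
  have e3 : (t2 : ℂ) * (-t1 - t2) * L1 + t1 * (-t1 - t2) * L2 + t1 * t2 * L3
      = -((1 - a2) * (1 - 1 / a2)) := by
    rw [htc, ht, hL1, hL2, hL3]; field_simp; ring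
  rw [← hD] at e1 e2
  have main : ρ * ((t2 : ℂ) * (-t1 - t2) * (L1 * G1) + t1 * (-t1 - t2) * (L2 * G2)
      + t1 * t2 * (L3 * G3)) = ρ * (-K * GK) := by
    have h1 : ρ * ((t2 : ℂ) * (-t1 - t2) * (L1 * G1) + t1 * (-t1 - t2) * (L2 * G2)
      + t1 * t2 * (L3 * G3)) = a1 * a2 * b1 * b2 * (1 - 1 / a2) ^ 2 + a1 * b1 * (a1 * b2) *
        ((1 - a2) ^ 2 / (a1 * a2 * b1 * b2)) + (a1 * b1 + a1 * b2) * ((1 - a2) * (1 - 1 / a2)) := by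
      rw [← e1, ← e2]
      linear_combination (-(t2 : ℂ) * (-t1 - t2) * L1) * hG1 - (t1 : ℂ) * (-t1 - t2) * L2 * hG2
        - (t1 : ℂ) * t2 * L3 * hG3 - (a1 * b1 + a1 * b2) * e3
    have h2 : ρ * (-K * GK) = -K * (a1 * (1 - b1) * (1 - b2)) := by rw [hGK]; ring
    rw [h1, h2, hK]
    field_simp
    ring
  have := mul_left_cancel₀ hρ main
  exact_mod_cast this
/-! ### Angles -/

/-- `e^{iθ}` -/
def ex (θ : ℝ) : ℂ := Complex.exp (θ * Complex.I)

lemma ex_add (p q : ℝ) : ex (p + q) = ex p * ex q := by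
  unfold ex; rw [← Complex.exp_add]; congr 1; push_cast; ring

lemma ex_norm (p : ℝ) : ‖ex p‖ = 1 := Complex.norm_exp_ofReal_mul_I p

lemma ex_ne (p : ℝ) : ex p ≠ 0 := Complex.exp_ne_zero _

lemma ex_zero : ex 0 = 1 := by simp [ex]

lemma ex_neg (p : ℝ) : ex (-p) = (ex p)⁻¹ := by
  unfold ex; rw [← Complex.exp_neg]; congr 1; push_cast; ring

lemma ex_eq (p : ℝ) : ex p = Real.cos p + Real.sin p * Complex.I := by
  unfold ex; rw [Complex.exp_mul_I]; push_cast; ring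

lemma ex_sub (p q : ℝ) :
    ex p - ex q = 2 * Complex.I * Real.sin ((p - q) / 2) * ex ((p + q) / 2) := by
  have h1 : ex p = ex ((p - q) / 2) * ex ((p + q) / 2) := by rw [← ex_add]; congr 1; ring
  have h2 : ex q = (ex ((p - q) / 2))⁻¹ * ex ((p + q) / 2) := by
    rw [← ex_neg, ← ex_add]; congr 1; ring
  rw [h1, h2, ← sub_mul, ← ex_neg, ex_eq ((p - q) / 2), ex_eq (-((p - q) / 2)), Real.cos_neg,
    Real.sin_neg]
  push_cast
  ring

lemma ex_inj {p q : ℝ} (h : Real.sin ((p - q) / 2) ≠ 0) : ex p ≠ ex q := by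
  rw [← sub_ne_zero, ex_sub]
  have h' : ((Real.sin ((p - q) / 2) : ℝ) : ℂ) ≠ 0 := Complex.ofReal_ne_zero.mpr h
  exact mul_ne_zero (mul_ne_zero (mul_ne_zero two_ne_zero Complex.I_ne_zero) h') (ex_ne _)

lemma ex_len (p q : ℝ) : ((4 * Real.sin ((p - q) / 2) ^ 2 : ℝ) : ℂ) =
    2 - ex p / ex q - ex q / ex p := by
  have h := ex_sub p q
  have h3 : ex ((p + q) / 2) * ex ((p + q) / 2) = ex p * ex q := by
    rw [← ex_add, ← ex_add]; congr 1; ring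
  have np := ex_ne p
  have nq := ex_ne q
  have h2 : 2 - ex p / ex q - ex q / ex p = -(ex p - ex q) ^ 2 / (ex p * ex q) := by
    field_simp; ring
  rw [h2, h, eq_div_iff (mul_ne_zero np nq), ← h3]
  simp only [Complex.ofReal_neg, Complex.ofReal_mul, Complex.ofReal_pow, Complex.ofReal_ofNat]
  linear_combination
    (-4 * (Real.sin ((p - q) / 2) : ℂ) ^ 2 * ex ((p + q) / 2) ^ 2) * Complex.I_sq * (-1)

lemma ex_dir (μ u1 u2 : ℝ) : ex μ * Real.sin (u2 - u1) =
    Real.sin (u2 - μ) * ex u1 + Real.sin (μ - u1) * ex u2 := by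
  rw [ex_eq μ, ex_eq u1, ex_eq u2, Real.sin_sub, Real.sin_sub, Real.sin_sub]
  push_cast
  have h1 := Complex.sin_sq_add_cos_sq (μ : ℂ)
  have h2 := Complex.sin_sq_add_cos_sq (u1 : ℂ)
  have h3 := Complex.sin_sq_add_cos_sq (u2 : ℂ)
  ring

lemma ex_G (a β1 β2 θ : ℝ) :
    ex (-θ) + ex a * ex β1 * (ex a * ex β2) / ex (-θ) - ex a * ex β1 - ex a * ex β2 =
    ex (a + (β1 + β2) / 2) *
      ((-4 * Real.sin ((a + β1 + θ) / 2) * Real.sin ((a + β2 + θ) / 2) : ℝ) : ℂ) := by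
  have n := ex_ne (-θ)
  have h1 := ex_sub (-θ) (a + β1)
  have h2 := ex_sub (-θ) (a + β2)
  rw [← ex_add, ← ex_add]
  have h3 : ex (-θ) + ex (a + β1) * ex (a + β2) / ex (-θ) - ex (a + β1) - ex (a + β2) =
      (ex (-θ) - ex (a + β1)) * (ex (-θ) - ex (a + β2)) / ex (-θ) := by
    field_simp; ring
  have h4 : ex ((-θ + (a + β1)) / 2) * ex ((-θ + (a + β2)) / 2) =
      ex (a + (β1 + β2) / 2) * ex (-θ) := by
    rw [← ex_add, ← ex_add]; congr 1; ring
  have h5 : (-θ - (a + β1)) / 2 = -((a + β1 + θ) / 2) := by ring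
  have h6 : (-θ - (a + β2)) / 2 = -((a + β2 + θ) / 2) := by ring
  rw [h3, h1, h2, div_eq_iff n, h5, h6, Real.sin_neg, Real.sin_neg]
  simp only [Complex.ofReal_neg, Complex.ofReal_mul, Complex.ofReal_pow, Complex.ofReal_ofNat]
  linear_combination (4 * Complex.I ^ 2 * (Real.sin ((a + β1 + θ) / 2) : ℂ) *
    (Real.sin ((a + β2 + θ) / 2) : ℂ)) * h4 + (4 * (Real.sin ((a + β1 + θ) / 2) : ℂ) *
    (Real.sin ((a + β2 + θ) / 2) : ℂ)) * ex (a + (β1 + β2) / 2) * ex (-θ) * Complex.I_sq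

lemma ex_GK (a β1 β2 : ℝ) :
    ex a * (1 - ex β1) * (1 - ex β2) =
    ex (a + (β1 + β2) / 2) *
      ((-4 * Real.sin (β1 / 2) * Real.sin (β2 / 2) : ℝ) : ℂ) := by
  have h1 := ex_sub 0 β1
  have h2 := ex_sub 0 β2
  rw [ex_zero] at h1 h2
  have h4 : ex a * (ex ((0 + β1) / 2) * ex ((0 + β2) / 2)) = ex (a + (β1 + β2) / 2) := by
    rw [← ex_add, ← ex_add]; congr 1; ring
  have h5 : (0 - β1) / 2 = -(β1 / 2) := by ring
  have h6 : (0 - β2) / 2 = -(β2 / 2) := by ring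
  rw [h1, h2, h5, h6, Real.sin_neg, Real.sin_neg, ← h4]
  simp only [Complex.ofReal_neg, Complex.ofReal_mul, Complex.ofReal_pow, Complex.ofReal_ofNat]
  linear_combination (4 * (Real.sin (β1 / 2) : ℂ) * (Real.sin (β2 / 2) : ℂ)) * ex a *
    (ex ((0 + β1) / 2) * ex ((0 + β2) / 2)) * Complex.I_sq

/-- decomposition of a chord along the two sides of the triangle -/
lemma ex_decomp (p q s γ1 γ2 : ℝ) (h1 : Real.sin (γ1 / 2) ≠ 0) (h2 : Real.sin (γ2 / 2) ≠ 0)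
    (h3 : Real.sin ((γ1 - γ2) / 2) ≠ 0) :
    ex p - ex q =
    ((Real.sin ((p - q) / 2) * Real.sin ((p + q) / 2 + s + γ2 / 2) /
      (Real.sin ((γ1 - γ2) / 2) * Real.sin (γ1 / 2)) : ℝ) : ℂ) * (ex (-(s + γ1)) - ex (-s)) +
    ((-(Real.sin ((p - q) / 2) * Real.sin ((p + q) / 2 + s + γ1 / 2) /
      (Real.sin ((γ1 - γ2) / 2) * Real.sin (γ2 / 2))) : ℝ) : ℂ) *
      (ex (-(s + γ2)) - ex (-s)) := by
  have e := ex_dir ((p + q) / 2) (-s - γ1 / 2) (-s - γ2 / 2)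
  rw [show -s - γ2 / 2 - (-s - γ1 / 2) = (γ1 - γ2) / 2 by ring,
    show -s - γ2 / 2 - (p + q) / 2 = -((p + q) / 2 + s + γ2 / 2) by ring,
    show (p + q) / 2 - (-s - γ1 / 2) = (p + q) / 2 + s + γ1 / 2 by ring, Real.sin_neg] at e
  rw [ex_sub p q, ex_sub (-(s + γ1)) (-s), ex_sub (-(s + γ2)) (-s),
    show (-(s + γ1) - -s) / 2 = -(γ1 / 2) by ring, show (-(s + γ2) - -s) / 2 = -(γ2 / 2) by ring,
    show (-(s + γ1) + -s) / 2 = -s - γ1 / 2 by ring,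
    show (-(s + γ2) + -s) / 2 = -s - γ2 / 2 by ring, Real.sin_neg, Real.sin_neg]
  have h1' : ((Real.sin (γ1 / 2) : ℝ) : ℂ) ≠ 0 := Complex.ofReal_ne_zero.mpr h1
  have h2' : ((Real.sin (γ2 / 2) : ℝ) : ℂ) ≠ 0 := Complex.ofReal_ne_zero.mpr h2
  have h3' : ((Real.sin ((γ1 - γ2) / 2) : ℝ) : ℂ) ≠ 0 := Complex.ofReal_ne_zero.mpr h3
  simp only [Complex.ofReal_neg, Complex.ofReal_div, Complex.ofReal_mul] at e ⊢
  generalize ((Real.sin (γ1 / 2) : ℝ) : ℂ) = k1 at *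
  generalize ((Real.sin (γ2 / 2) : ℝ) : ℂ) = k2 at *
  generalize ((Real.sin ((γ1 - γ2) / 2) : ℝ) : ℂ) = k3 at *
  generalize ((Real.sin ((p + q) / 2 + s + γ1 / 2) : ℝ) : ℂ) = k4 at *
  generalize ((Real.sin ((p + q) / 2 + s + γ2 / 2) : ℝ) : ℂ) = k5 at *
  generalize ((Real.sin ((p - q) / 2) : ℝ) : ℂ) = k6 at *
  generalize ex (-s - γ1 / 2) = k7 at *
  generalize ex (-s - γ2 / 2) = k8 at *
  generalize ex ((p + q) / 2) = k9 at *
  field_simp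
  linear_combination k6 * e
/-! ### The angle lemmas -/

lemma AL_gen (a a' β1 β2 γ1 γ2 s s1 s2 t1 t2 : ℝ)
    (hS : ex (a + a' + β1 + β2 + γ1 + γ2 + 3 * s) = 1)
    (ha' : 0 < Real.sin (a' / 2)) (hβ1 : 0 < Real.sin (β1 / 2)) (hβ2 : 0 < Real.sin (β2 / 2))
    (hβ : Real.sin ((β1 - β2) / 2) ≠ 0)
    (hγ1 : Real.sin (γ1 / 2) ≠ 0) (hγ2 : Real.sin (γ2 / 2) ≠ 0)
    (hγ : Real.sin ((γ1 - γ2) / 2) ≠ 0)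
    (hs : 1 - ex (-s) = s1 * (ex (-(s + γ1)) - ex (-s)) + s2 * (ex (-(s + γ2)) - ex (-s)))
    (ht : 1 - ex a' = t1 * (ex (-(s + γ1)) - ex (-s)) + t2 * (ex (-(s + γ2)) - ex (-s)))
    (hroot : ∀ E3 : ℝ, ∀ E1 E2 : ℝ,
      E1 = 4 * Real.sin (γ2 / 2) ^ 2 *
        (-4 * Real.sin ((a + β1 + (s + γ1)) / 2) * Real.sin ((a + β2 + (s + γ1)) / 2)) →
      E2 = 4 * Real.sin (γ1 / 2) ^ 2 *
        (-4 * Real.sin ((a + β1 + (s + γ2)) / 2) * Real.sin ((a + β2 + (s + γ2)) / 2)) →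
      0 < t2 * (-t1 - t2) * E1 + t1 * (-t1 - t2) * E2 + t1 * t2 * E3 →
      ∃ y, 0 < y ∧ s1 + y * t1 ≤ 0 ∧ s2 + y * t2 ≤ 0 ∧ FF s1 s2 t1 t2 E1 E2 E3 y = 0) :
    VC (ex a) (ex a') (ex β1) (ex β2) (ex γ1) (ex γ2) (ex (-s)) := by
  have hD : ex a * ex a' * ex β1 * ex β2 = ex (-(s + γ1)) * ex (-(s + γ2)) * ex (-s) := by
    have h1 : ex a * ex a' * ex β1 * ex β2 = ex (a + a' + β1 + β2 + γ1 + γ2 + 3 * s) *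
        (ex (-(s + γ1)) * ex (-(s + γ2)) * ex (-s)) := by
      simp only [← ex_add]; congr 1; ring
    rw [h1, hS, one_mul]
  have hL1 := ex_len (-(s + γ2)) (-s)
  have hL2 := ex_len (-(s + γ1)) (-s)
  have hL3 := ex_len (-(s + γ1)) (-(s + γ2))
  have r1 : (-(s + γ1) - -s) / 2 = -(γ1 / 2) := by ring
  have r2 : (-(s + γ2) - -s) / 2 = -(γ2 / 2) := by ring
  have r3 : (-(s + γ1) - -(s + γ2)) / 2 = -((γ1 - γ2) / 2) := by ring
  rw [r2, Real.sin_neg, neg_sq] at hL1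
  rw [r1, Real.sin_neg, neg_sq] at hL2
  rw [r3, Real.sin_neg, neg_sq] at hL3
  have hK : ((4 * Real.sin (a' / 2) ^ 2 : ℝ) : ℂ) = 2 - ex a' - 1 / ex a' := by
    have := ex_len a' 0
    rw [ex_zero, div_one, sub_zero] at this
    exact this
  have hG1 := ex_G a β1 β2 (s + γ1)
  have hG2 := ex_G a β1 β2 (s + γ2)
  have hG3 := ex_G a β1 β2 s
  have hGK := ex_GK a β1 β2
  have hlead := lead_lemma (ex_ne a) (ex_ne a') (ex_ne β1) (ex_ne β2) (ex_norm _) (ex_norm _)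
    (ex_norm _) (ex_norm _) (ex_ne _) hD t1 t2 _ _ _ _ _ _ _ _ hL1 hL2 hL3 hK hG1 hG2 hG3 hGK ht
  obtain ⟨y, hy, hw1, hw2, hF⟩ := hroot (4 * Real.sin ((γ1 - γ2) / 2) ^ 2 *
    (-4 * Real.sin ((a + β1 + s) / 2) * Real.sin ((a + β2 + s) / 2))) _ _ rfl rfl (by
      rw [hlead]
      have : 0 < 4 * Real.sin (a' / 2) ^ 2 * (4 * Real.sin (β1 / 2) * Real.sin (β2 / 2)) := by
        positivity
      linarith)
  refine VC_of_root (ex_norm _) (ex_norm _) (ex_norm _) (ex_norm _) (ex_norm (-(s + γ1)))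
    (ex_norm (-(s + γ2))) (ex_norm _) (ex_inj ?_) (ex_inj ?_) (ex_inj ?_) ?_ ?_ hD
    (ex_inj hβ) y (s1 + y * t1) (s2 + y * t2) (1 - (s1 + y * t1) - (s2 + y * t2))
    _ _ _ _ _ _ _ (by ring) hw1 hw2 hL1 hL2 hL3 (by positivity) (by positivity) (by positivity)
    hK (by positivity) ?_ hy hG1 hG2 hG3 ?_
  · rw [r3, Real.sin_neg]; exact neg_ne_zero.mpr hγ
  · rw [r1, Real.sin_neg]; exact neg_ne_zero.mpr hγ1
  · rw [r2, Real.sin_neg]; exact neg_ne_zero.mpr hγ2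
  · rw [← ex_add]; congr 1; ring
  · rw [← ex_add]; congr 1; ring
  · push_cast
    linear_combination hs + y * ht
  · unfold FF at hF
    linear_combination hF

lemma ex_decomp_s (s γ1 γ2 : ℝ) (h1 : Real.sin (γ1 / 2) ≠ 0) (h2 : Real.sin (γ2 / 2) ≠ 0)
    (h3 : Real.sin ((γ1 - γ2) / 2) ≠ 0) :
    1 - ex (-s) =
    ((Real.sin (s / 2) * Real.sin ((s + γ2) / 2) /
      (Real.sin ((γ1 - γ2) / 2) * Real.sin (γ1 / 2)) : ℝ) : ℂ) * (ex (-(s + γ1)) - ex (-s)) +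
    ((-(Real.sin (s / 2) * Real.sin ((s + γ1) / 2) /
      (Real.sin ((γ1 - γ2) / 2) * Real.sin (γ2 / 2))) : ℝ) : ℂ) *
      (ex (-(s + γ2)) - ex (-s)) := by
  have h := ex_decomp 0 (-s) s γ1 γ2 h1 h2 h3
  rw [ex_zero, show (0 - -s) / 2 = s / 2 by ring,
    show (0 + -s) / 2 + s + γ1 / 2 = (s + γ1) / 2 by ring,
    show (0 + -s) / 2 + s + γ2 / 2 = (s + γ2) / 2 by ring] at h
  exact h

lemma ex_decomp_a (a' s γ1 γ2 : ℝ) (h1 : Real.sin (γ1 / 2) ≠ 0) (h2 : Real.sin (γ2 / 2) ≠ 0)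
    (h3 : Real.sin ((γ1 - γ2) / 2) ≠ 0) :
    1 - ex a' =
    ((-(Real.sin (a' / 2) * Real.sin ((a' + γ2) / 2 + s) /
      (Real.sin ((γ1 - γ2) / 2) * Real.sin (γ1 / 2))) : ℝ) : ℂ) * (ex (-(s + γ1)) - ex (-s)) +
    ((Real.sin (a' / 2) * Real.sin ((a' + γ1) / 2 + s) /
      (Real.sin ((γ1 - γ2) / 2) * Real.sin (γ2 / 2)) : ℝ) : ℂ) *
      (ex (-(s + γ2)) - ex (-s)) := by
  have h := ex_decomp 0 a' s γ1 γ2 h1 h2 h3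
  rw [ex_zero, show (0 - a') / 2 = -(a' / 2) by ring,
    show (0 + a') / 2 + s + γ1 / 2 = (a' + γ1) / 2 + s by ring,
    show (0 + a') / 2 + s + γ2 / 2 = (a' + γ2) / 2 + s by ring, Real.sin_neg] at h
  rw [h]
  simp only [neg_mul, neg_div, neg_neg]

lemma AL (a a' β1 β2 γ1 γ2 s : ℝ)
    (hS : ex (a + a' + β1 + β2 + γ1 + γ2 + 3 * s) = 1)
    (ha' : 0 < Real.sin (a' / 2)) (hβ1 : 0 < Real.sin (β1 / 2)) (hβ2 : 0 < Real.sin (β2 / 2))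
    (hβ : Real.sin ((β1 - β2) / 2) ≠ 0)
    (hγ1 : 0 < Real.sin (γ1 / 2)) (hγ2 : 0 < Real.sin (γ2 / 2))
    (hs : 0 < Real.sin (s / 2) * Real.sin ((γ1 - γ2) / 2))
    (hsγ : 0 < Real.sin ((s + γ2) / 2))
    (hag : 0 < Real.sin ((γ1 - γ2) / 2) * Real.sin ((a' + γ2) / 2 + s))
    (has : 0 ≤ Real.sin ((a' + s) / 2))
    (hg1 : Real.sin ((a + β1 + (s + γ1)) / 2) * Real.sin ((a + β2 + (s + γ1)) / 2) ≤ 0)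
    (hg2 : 0 ≤ Real.sin ((a + β1 + (s + γ2)) / 2) * Real.sin ((a + β2 + (s + γ2)) / 2) ∨
      Real.sin ((γ1 - γ2) / 2) * Real.sin ((a' + γ1) / 2 + s) ≤ 0) :
    VC (ex a) (ex a') (ex β1) (ex β2) (ex γ1) (ex γ2) (ex (-s)) := by
  have hγ : Real.sin ((γ1 - γ2) / 2) ≠ 0 := by
    intro h; rw [h] at hs; simp at hs
  have hh : 0 < Real.sin ((γ1 - γ2) / 2) ^ 2 := by positivity
  refine AL_gen a a' β1 β2 γ1 γ2 s _ _ _ _ hS ha' hβ1 hβ2 hβ hγ1.ne' hγ2.ne' hγ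
    (ex_decomp_s s γ1 γ2 hγ1.ne' hγ2.ne' hγ) (ex_decomp_a a' s γ1 γ2 hγ1.ne' hγ2.ne' hγ) ?_
  intro E3 E1 E2 hE1 hE2 hlead
  have key : Real.sin ((s + γ1) / 2) * Real.sin ((a' + γ2) / 2 + s) -
      Real.sin ((s + γ2) / 2) * Real.sin ((a' + γ1) / 2 + s) =
      Real.sin ((a' + s) / 2) * Real.sin ((γ1 - γ2) / 2) := by
    rw [show (a' + γ2) / 2 + s = (s + γ2) / 2 + (a' + s) / 2 by ring,
      show (a' + γ1) / 2 + s = (s + γ1) / 2 + (a' + s) / 2 by ring,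
      show (γ1 - γ2) / 2 = (s + γ1) / 2 - (s + γ2) / 2 by ring, Real.sin_add, Real.sin_add,
      Real.sin_sub]
    ring
  generalize Real.sin ((γ1 - γ2) / 2) = h at *
  generalize Real.sin (s / 2) = k1 at *
  generalize Real.sin ((s + γ1) / 2) = k2 at *
  generalize Real.sin ((s + γ2) / 2) = k3 at *
  generalize Real.sin ((a' + γ1) / 2 + s) = k4 at *
  generalize Real.sin ((a' + γ2) / 2 + s) = k5 at *
  generalize Real.sin ((a' + s) / 2) = k6 at *
  generalize Real.sin (a' / 2) = k7 at *
  generalize Real.sin (γ1 / 2) = k8 at *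
  generalize Real.sin (γ2 / 2) = k9 at *
  apply root_exists _ _ _ _ _ _ _ _ _ _ _ _ hlead
  · have : k1 * k3 / (h * k8) = (k1 * h) * k3 / (h ^ 2 * k8) := by field_simp
    rw [this]; positivity
  · have : k7 * k5 / (h * k8) = (h * k5) * k7 / (h ^ 2 * k8) := by field_simp
    rw [this]
    have : 0 < (h * k5) * k7 / (h ^ 2 * k8) := by positivity
    linarith
  · have : -(k1 * k2 / (h * k9)) * -(k7 * k5 / (h * k8)) -
        k1 * k3 / (h * k8) * (k7 * k4 / (h * k9)) = (k1 * h) * k6 * k7 / (h ^ 2 * k8 * k9) := by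
      field_simp
      linear_combination k1 * key
    rw [this]; positivity
  · rw [hE1]
    apply mul_nonneg (by positivity); linarith
  · rcases hg2 with hg | hg
    · left; rw [hE2]
      have : 0 ≤ 4 * k8 ^ 2 * (4 * (Real.sin ((a + β1 + (s + γ2)) / 2) *
        Real.sin ((a + β2 + (s + γ2)) / 2))) := by positivity
      linarith
    · right
      have : k7 * k4 / (h * k9) = (h * k4) * k7 / (h ^ 2 * k9) := by field_simp
      rw [this]
      apply div_nonpos_of_nonpos_of_nonneg _ (by positivity)
      exact mul_nonpos_of_nonpos_of_nonneg hg ha'.le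

/-- the case of zero scalar angle, irreducible solution -/
lemma AL0 (a a' β1 β2 γ1 γ2 : ℝ)
    (hS : ex (a + a' + β1 + β2 + γ1 + γ2) = 1)
    (ha' : 0 < Real.sin (a' / 2)) (hβ1 : 0 < Real.sin (β1 / 2)) (hβ2 : 0 < Real.sin (β2 / 2))
    (hβ : Real.sin ((β1 - β2) / 2) ≠ 0)
    (hγ1 : 0 < Real.sin (γ1 / 2)) (hγ2 : 0 < Real.sin (γ2 / 2))
    (hγ : 0 < Real.sin ((γ1 - γ2) / 2))
    (hag : 0 < Real.sin ((a' + γ2) / 2))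
    (hag' : Real.sin ((a' + γ1) / 2) < 0)
    (hg1 : Real.sin ((a + β1 + γ1) / 2) * Real.sin ((a + β2 + γ1) / 2) ≤ 0)
    (hg2 : Real.sin ((a + β1 + γ2) / 2) * Real.sin ((a + β2 + γ2) / 2) < 0) :
    VC (ex a) (ex a') (ex β1) (ex β2) (ex γ1) (ex γ2) 1 := by
  have h0 : (1 : ℂ) = ex (-0) := by rw [neg_zero, ex_zero]
  rw [h0]
  refine AL_gen a a' β1 β2 γ1 γ2 0 0 0 _ _ (by simpa using hS) ha' hβ1 hβ2 hβ hγ1.ne' hγ2.ne'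
    hγ.ne' (by simp [ex_zero]) (ex_decomp_a a' 0 γ1 γ2 hγ1.ne' hγ2.ne' hγ.ne') ?_
  intro E3 E1 E2 hE1 hE2 hlead
  have hr := fun h1 h2 h3 h4 => root_exists_zero _ _ _ _ _ h1 h2 h3 h4 hlead
  simp only [add_zero, zero_add] at *
  apply hr
  · have : 0 < Real.sin (a' / 2) * Real.sin ((a' + γ2) / 2) /
      (Real.sin ((γ1 - γ2) / 2) * Real.sin (γ1 / 2)) := by positivity
    linarith
  · apply div_neg_of_neg_of_pos
    · exact mul_neg_of_pos_of_neg ha' hag'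
    · positivity
  · rw [hE1]
    apply mul_nonneg (by positivity); linarith
  · rw [hE2]
    apply mul_pos (by positivity); linarith

lemma AL_cross (a a' β1 β2 γ1 γ2 : ℝ)
    (hS : ex (a + a' + β1 + β2 + γ1 + γ2) = 1)
    (hβ : Real.sin ((β1 - β2) / 2) ≠ 0)
    (hγ1 : Real.sin (γ1 / 2) ≠ 0) (hγ2 : Real.sin (γ2 / 2) ≠ 0)
    (hγ : Real.sin ((γ1 - γ2) / 2) ≠ 0)
    (hg1 : Real.sin ((a + β1 + γ1) / 2) * Real.sin ((a + β2 + γ1) / 2) ≤ 0)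
    (hg2 : 0 ≤ Real.sin ((a + β1 + γ2) / 2) * Real.sin ((a + β2 + γ2) / 2)) :
    VC (ex a) (ex a') (ex β1) (ex β2) (ex γ1) (ex γ2) 1 := by
  have hD : ex a * ex a' * ex β1 * ex β2 = ex (-γ1) * ex (-γ2) * 1 := by
    have h1 : ex a * ex a' * ex β1 * ex β2 = ex (a + a' + β1 + β2 + γ1 + γ2) *
        (ex (-γ1) * ex (-γ2)) := by
      simp only [← ex_add]; congr 1; ring
    rw [h1, hS, one_mul, mul_one]
  refine VC_cross (ex_norm _) (ex_norm _) (ex_norm _) (ex_norm _) (ex_norm (-γ1))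
    (ex_norm (-γ2)) (ex_inj ?_) ?_ ?_ ?_ ?_ hD (ex_inj hβ) _ _ (ex_G a β1 β2 γ1)
    (ex_G a β1 β2 γ2) (by linarith) (by linarith)
  · rw [show (-γ1 - -γ2) / 2 = -((γ1 - γ2) / 2) by ring, Real.sin_neg]; exact neg_ne_zero.mpr hγ
  · rw [← ex_zero]; apply ex_inj
    rw [show (-γ1 - 0) / 2 = -(γ1 / 2) by ring, Real.sin_neg]; exact neg_ne_zero.mpr hγ1
  · rw [← ex_zero]; apply ex_inj
    rw [show (-γ2 - 0) / 2 = -(γ2 / 2) by ring, Real.sin_neg]; exact neg_ne_zero.mpr hγ2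
  · rw [← ex_add, neg_add_cancel, ex_zero]
  · rw [← ex_add, neg_add_cancel, ex_zero]
/-! ### Symmetries of the solution set -/

lemma memU21_of_conj {P D : M3} (hP : memU21 P) (hD : memU21 D) : memU21 (P * D * P⁻¹) :=
  memU21_mul (memU21_mul hP hD) (memU21_inv hP)

/-- conjugacy to `diag(a₁,a₂,1)` in U(2,1) -/
def Cj (M : M3) (a1 a2 : ℂ) : Prop := ∃ P : M3, memU21 P ∧ M = P * Ec a1 a2 * P⁻¹

lemma VC_iff {a1 a2 b1 b2 g1 g2 u : ℂ} : VC a1 a2 b1 b2 g1 g2 u ↔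
    ∃ A B C : M3, Cj A a1 a2 ∧ Cj B b1 b2 ∧ Cj C g1 g2 ∧ A * B * C = u • (1 : M3) := by
  constructor
  · rintro ⟨P1, P2, P3, h1, h2, h3, h⟩
    exact ⟨_, _, _, ⟨P1, h1, rfl⟩, ⟨P2, h2, rfl⟩, ⟨P3, h3, rfl⟩, h⟩
  · rintro ⟨A, B, C, ⟨P1, h1, rfl⟩, ⟨P2, h2, rfl⟩, ⟨P3, h3, rfl⟩, h⟩
    exact ⟨P1, P2, P3, h1, h2, h3, h⟩

/-- the transposition of the first two coordinates -/
def Sw : M3 := !![0, 1, 0; 1, 0, 0; 0, 0, 1]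

lemma Sw_sq : Sw * Sw = 1 := by
  ext i j
  fin_cases i <;> fin_cases j <;> simp [Sw, Matrix.mul_apply, Fin.sum_univ_three]

lemma memU21_Sw : memU21 Sw := by
  unfold memU21
  ext i j
  fin_cases i <;> fin_cases j <;>
    simp [Sw, J3, Matrix.mul_apply, Fin.sum_univ_three, Matrix.diagonal_apply]

lemma Sw_conj (a1 a2 : ℂ) : Sw * Ec a1 a2 * Sw = Ec a2 a1 := by
  ext i j
  fin_cases i <;> fin_cases j <;>
    simp [Sw, Ec, Matrix.mul_apply, Fin.sum_univ_three, Matrix.vecMul_diagonal]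

lemma Cj_swap {M : M3} {a1 a2 : ℂ} (h : Cj M a1 a2) : Cj M a2 a1 := by
  obtain ⟨P, hP, rfl⟩ := h
  refine ⟨P * Sw, memU21_mul hP memU21_Sw, ?_⟩
  have hSi : Sw⁻¹ = Sw := Matrix.inv_eq_left_inv Sw_sq
  rw [Matrix.mul_inv_rev, hSi, ← Sw_conj a2 a1]
  simp only [Matrix.mul_assoc]

lemma VC_swap1 {a1 a2 b1 b2 g1 g2 u : ℂ} (h : VC a1 a2 b1 b2 g1 g2 u) :
    VC a2 a1 b1 b2 g1 g2 u := by
  rw [VC_iff] at *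
  obtain ⟨A, B, C, hA, hB, hC, h⟩ := h
  exact ⟨A, B, C, Cj_swap hA, hB, hC, h⟩

lemma VC_swap2 {a1 a2 b1 b2 g1 g2 u : ℂ} (h : VC a1 a2 b1 b2 g1 g2 u) :
    VC a1 a2 b2 b1 g1 g2 u := by
  rw [VC_iff] at *
  obtain ⟨A, B, C, hA, hB, hC, h⟩ := h
  exact ⟨A, B, C, hA, Cj_swap hB, hC, h⟩

lemma VC_swap3 {a1 a2 b1 b2 g1 g2 u : ℂ} (h : VC a1 a2 b1 b2 g1 g2 u) :
    VC a1 a2 b1 b2 g2 g1 u := by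
  rw [VC_iff] at *
  obtain ⟨A, B, C, hA, hB, hC, h⟩ := h
  exact ⟨A, B, C, hA, hB, Cj_swap hC, h⟩

lemma memU21_Ec {a1 a2 : ℂ} (h1 : ‖a1‖ = 1) (h2 : ‖a2‖ = 1) : memU21 (Ec a1 a2) :=
  memU21_diag (by intro i; fin_cases i <;> simp [h1, h2])

/-- cyclic rotation -/
lemma VC_rot {a1 a2 b1 b2 g1 g2 u : ℂ} (hg1 : ‖g1‖ = 1) (hg2 : ‖g2‖ = 1)
    (h : VC a1 a2 b1 b2 g1 g2 u) : VC g1 g2 a1 a2 b1 b2 u := by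
  rw [VC_iff] at *
  obtain ⟨A, B, C, hA, hB, hC, h⟩ := h
  refine ⟨C, A, B, hC, hA, hB, ?_⟩
  obtain ⟨P, hP, rfl⟩ := hC
  have hCu := memU21_isUnit (memU21_of_conj hP (memU21_Ec hg1 hg2))
  generalize P * Ec g1 g2 * P⁻¹ = C at *
  have h1 : A * B = u • C⁻¹ := by
    calc A * B = A * B * C * C⁻¹ := by
          rw [Matrix.mul_assoc, Matrix.mul_nonsing_inv _ hCu, Matrix.mul_one]
      _ = u • C⁻¹ := by rw [h, Matrix.smul_mul, Matrix.one_mul]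
  rw [Matrix.mul_assoc, h1, Matrix.mul_smul, Matrix.mul_nonsing_inv _ hCu]

/-- entrywise complex conjugation -/
def cj (M : M3) : M3 := M.map (starRingEnd ℂ)

lemma cj_mul (M N : M3) : cj (M * N) = cj M * cj N := Matrix.map_mul

lemma cj_J3 : cj J3 = J3 := by
  unfold cj J3
  rw [Matrix.diagonal_map (map_zero _)]
  congr 1; funext i; fin_cases i <;> simp

lemma cj_one : cj 1 = 1 := by
  unfold cj
  rw [Matrix.map_one _ (map_zero _) (map_one _)]

lemma memU21_cj {P : M3} (h : memU21 P) : memU21 (cj P) := by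
  have h2 := congrArg cj h
  rw [cj_mul, cj_mul, cj_J3] at h2
  have : cj (Pᴴ) = (cj P)ᴴ := by
    ext i j; simp [cj]
  rw [this] at h2
  exact h2

lemma cj_inv {P : M3} (h : memU21 P) : cj P⁻¹ = (cj P)⁻¹ := by
  symm
  apply Matrix.inv_eq_left_inv
  rw [← cj_mul, Matrix.nonsing_inv_mul _ (memU21_isUnit h), cj_one]

lemma cj_Ec (a1 a2 : ℂ) : cj (Ec a1 a2) = Ec (starRingEnd ℂ a1) (starRingEnd ℂ a2) := by
  unfold cj Ec
  rw [Matrix.diagonal_map (map_zero _)]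
  congr 1; funext i; fin_cases i <;> simp

lemma Cj_cj {M : M3} {a1 a2 : ℂ} (h : Cj M a1 a2) :
    Cj (cj M) (starRingEnd ℂ a1) (starRingEnd ℂ a2) := by
  obtain ⟨P, hP, rfl⟩ := h
  exact ⟨cj P, memU21_cj hP, by rw [cj_mul, cj_mul, cj_inv hP, cj_Ec]⟩

lemma VC_conj {a1 a2 b1 b2 g1 g2 u : ℂ} (h : VC a1 a2 b1 b2 g1 g2 u) :
    VC (starRingEnd ℂ a1) (starRingEnd ℂ a2) (starRingEnd ℂ b1) (starRingEnd ℂ b2)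
      (starRingEnd ℂ g1) (starRingEnd ℂ g2) (starRingEnd ℂ u) := by
  rw [VC_iff] at *
  obtain ⟨A, B, C, hA, hB, hC, h⟩ := h
  refine ⟨cj A, cj B, cj C, Cj_cj hA, Cj_cj hB, Cj_cj hC, ?_⟩
  rw [← cj_mul, ← cj_mul, h]
  ext i j
  by_cases hij : i = j
  · subst hij; simp [cj]
  · simp [cj, hij]

lemma ex_conj (p : ℝ) : starRingEnd ℂ (ex p) = ex (-p) := by
  rw [conj_unit (ex_norm p), ex_neg]

lemma ex_two_pi (p : ℝ) : ex (2 * π - p) = ex (-p) := by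
  rw [sub_eq_add_neg, ex_add]
  have : ex (2 * π) = 1 := by
    unfold ex; push_cast; exact Complex.exp_two_pi_mul_I
  rw [this, one_mul]

/-- solution of the problem with angles; `s` is minus the angle of the scalar -/
def VV (a1 a2 b1 b2 g1 g2 s : ℝ) : Prop :=
  VC (ex a1) (ex a2) (ex b1) (ex b2) (ex g1) (ex g2) (ex (-s))

lemma VV_rot {a1 a2 b1 b2 g1 g2 s : ℝ} (h : VV a1 a2 b1 b2 g1 g2 s) : VV g1 g2 a1 a2 b1 b2 s :=
  VC_rot (ex_norm _) (ex_norm _) h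

/-- duality -/
lemma VV_dual {a1 a2 b1 b2 g1 g2 s : ℝ}
    (h : VV (2 * π - a2) (2 * π - a1) (2 * π - b2) (2 * π - b1) (2 * π - g2) (2 * π - g1) (-s)) :
    VV a1 a2 b1 b2 g1 g2 s := by
  unfold VV at *
  simp only [ex_two_pi] at h
  have h2 := VC_conj h
  simp only [ex_conj, neg_neg] at h2
  exact VC_swap1 (VC_swap2 (VC_swap3 h2))

lemma Lmat_eq (a1 a2 : ℝ) : Lmat a1 a2 = ex (-(a1 + a2) / 3) • Ec (ex a1) (ex a2) := by
  unfold Lmat Ec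
  rw [← Matrix.diagonal_smul]
  congr 1
  funext i
  fin_cases i
  · simp only [Fin.zero_eta, Matrix.cons_val_zero, Pi.smul_apply, smul_eq_mul]
    rw [← ex_add]; unfold ex; congr 1; push_cast; ring
  · simp only [Fin.mk_one, Matrix.cons_val_one, Matrix.cons_val_zero, Pi.smul_apply, smul_eq_mul]
    rw [← ex_add]; unfold ex; congr 1; push_cast; ring
  · simp [ex]

lemma memU21_Lmat (a1 a2 : ℝ) : memU21 (Lmat a1 a2) := by
  have h : Lmat a1 a2 = Matrix.diagonal ![ex ((2 * a1 - a2) / 3), ex ((2 * a2 - a1) / 3),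
      ex (-(a1 + a2) / 3)] := by
    unfold Lmat ex; push_cast; rfl
  rw [h]
  apply memU21_diag
  intro i
  fin_cases i <;> simp [ex_norm]

lemma Psol_of_VV {τ : Tri} (hT : memT3 τ) {u : ℂ} {s : ℝ}
    (h : VV τ.1.1 τ.1.2 τ.2.1.1 τ.2.1.2 τ.2.2.1 τ.2.2.2 s) (hu : u = ex (-s - Sf τ / 3)) :
    τ ∈ Psol u := by
  obtain ⟨P1, P2, P3, h1, h2, h3, h⟩ := h
  refine ⟨hT, P1 * Lmat τ.1.1 τ.1.2 * P1⁻¹, P2 * Lmat τ.2.1.1 τ.2.1.2 * P2⁻¹,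
    P3 * Lmat τ.2.2.1 τ.2.2.2 * P3⁻¹, memU21_of_conj h1 (memU21_Lmat _ _),
    memU21_of_conj h2 (memU21_Lmat _ _), memU21_of_conj h3 (memU21_Lmat _ _),
    ⟨P1, h1, rfl⟩, ⟨P2, h2, rfl⟩, ⟨P3, h3, rfl⟩, ?_⟩
  rw [Lmat_eq, Lmat_eq, Lmat_eq]
  simp only [Matrix.mul_smul, Matrix.smul_mul]
  rw [h, smul_smul, smul_smul, smul_smul, hu, ← ex_add, ← ex_add, ← ex_add]
  congr 2
  unfold Sf
  ring
/-! ### The cells -/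

lemma sp {x : ℝ} (h0 : 0 < x) (h1 : x < 2 * π) : 0 < Real.sin (x / 2) :=
  Real.sin_pos_of_pos_of_lt_pi (by linarith) (by linarith)

lemma sp' {x : ℝ} (h0 : 0 ≤ x) (h1 : x ≤ 2 * π) : 0 ≤ Real.sin (x / 2) :=
  Real.sin_nonneg_of_nonneg_of_le_pi (by linarith) (by linarith)

lemma sm {x : ℝ} (h0 : -(2 * π) < x) (h1 : x < 0) : Real.sin (x / 2) < 0 :=
  Real.sin_neg_of_neg_of_neg_pi_lt (by linarith) (by linarith)

lemma sn {x : ℝ} (h0 : 2 * π < x) (h1 : x < 4 * π) : Real.sin (x / 2) < 0 := by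
  have h : 0 < Real.sin ((x - 2 * π) / 2) := sp (by linarith) (by linarith)
  have e : (x - 2 * π) / 2 = x / 2 - π := by ring
  rw [e, Real.sin_sub_pi] at h
  linarith

lemma sn' {x : ℝ} (h0 : 2 * π ≤ x) (h1 : x ≤ 4 * π) : Real.sin (x / 2) ≤ 0 := by
  have h : 0 ≤ Real.sin ((x - 2 * π) / 2) := sp' (by linarith) (by linarith)
  have e : (x - 2 * π) / 2 = x / 2 - π := by ring
  rw [e, Real.sin_sub_pi] at h
  linarith

lemma sq4 {x : ℝ} (h0 : 4 * π < x) (h1 : x < 6 * π) : 0 < Real.sin (x / 2) := by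
  have h : Real.sin ((x - 2 * π) / 2) < 0 := sn (by linarith) (by linarith)
  have e : (x - 2 * π) / 2 = x / 2 - π := by ring
  rw [e, Real.sin_sub_pi] at h
  linarith

lemma ex_2pi : ex (2 * π) = 1 := by
  unfold ex; push_cast; exact Complex.exp_two_pi_mul_I

lemma ex_4pi : ex (4 * π) = 1 := by
  rw [show 4 * π = 2 * π + 2 * π by ring, ex_add, ex_2pi, one_mul]

lemma ex_6pi : ex (6 * π) = 1 := by
  rw [show 6 * π = 4 * π + 2 * π by ring, ex_add, ex_2pi, ex_4pi, one_mul]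

lemma cell4a {a1 a2 b1 b2 g1 g2 s : ℝ} (hS : a1 + a2 + b1 + b2 + g1 + g2 + 3 * s = 4 * π)
    (ha2 : 0 < a2) (ha : a2 < a1) (ha1 : a1 < 2 * π)
    (hb2 : 0 < b2) (hb : b2 < b1) (hb1 : b1 < 2 * π)
    (hg2 : 0 < g2) (hg : g2 < g1) (hg1 : g1 < 2 * π)
    (H : 2 * (a2 + b2 + g2) - (a1 + b1 + g1) < -(4 * π)) :
    VV a1 a2 b1 b2 g1 g2 s := by
  refine VC_swap1 (VC_swap3 (AL a2 a1 b1 b2 g2 g1 s ?_ ?_ ?_ ?_ ?_ ?_ ?_ ?_ ?_ ?_ ?_ ?_ ?_))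
  · rw [show a2 + a1 + b1 + b2 + g2 + g1 + 3 * s = 4 * π by linarith, ex_4pi]
  · exact sp (by linarith) ha1
  · exact sp (by linarith) hb1
  · exact sp hb2 (by linarith)
  · exact (sp (by linarith) (by linarith)).ne'
  · exact sp hg2 (by linarith)
  · exact sp (by linarith) (by linarith)
  · exact mul_pos_of_neg_of_neg (sm (by linarith) (by linarith)) (sm (by linarith) (by linarith))
  · exact sp (by linarith) (by linarith)
  · rw [show (a1 + g1) / 2 + s = (a1 + g1 + 2 * s) / 2 by ring]
    exact mul_pos_of_neg_of_neg (sm (by linarith) (by linarith)) (sn (by linarith) (by linarith))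
  · exact sp' (by linarith) (by linarith)
  · exact (mul_neg_of_pos_of_neg (sp (by linarith) (by linarith))
      (sm (by linarith) (by linarith))).le
  · right
    rw [show (a1 + g2) / 2 + s = (a1 + g2 + 2 * s) / 2 by ring]
    exact (mul_neg_of_neg_of_pos (sm (by linarith) (by linarith))
      (sp (by linarith) (by linarith))).le

lemma cell4_core {a a' b1 b2 g1 g2 s : ℝ} (hS : a + a' + b1 + b2 + g1 + g2 + 3 * s = 4 * π)
    (ha0 : 0 < a) (ha : 0 < a') (ha1 : a' < 2 * π)
    (hb2 : 0 < b2) (hb : b2 < b1) (hb1 : b1 < 2 * π)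
    (hg2 : 0 < g2) (hg : g2 < g1) (hg1 : g1 < 2 * π) (hs : 0 < s)
    (h1 : 2 * π ≤ a + b1 + (s + g1)) (h2 : a + b2 + (s + g1) ≤ 2 * π)
    (h3 : a + b1 + (s + g2) ≤ 2 * π) :
    VV a a' b1 b2 g1 g2 s := by
  refine AL a a' b1 b2 g1 g2 s ?_ ?_ ?_ ?_ ?_ ?_ ?_ ?_ ?_ ?_ ?_ ?_ ?_
  · rw [hS, ex_4pi]
  · exact sp ha ha1
  · exact sp (by linarith) hb1
  · exact sp hb2 (by linarith)
  · exact (sp (by linarith) (by linarith)).ne'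
  · exact sp (by linarith) (by linarith)
  · exact sp hg2 (by linarith)
  · exact mul_pos (sp (by linarith) (by linarith)) (sp (by linarith) (by linarith))
  · exact sp (by linarith) (by linarith)
  · rw [show (a' + g2) / 2 + s = (a' + g2 + 2 * s) / 2 by ring]
    exact mul_pos (sp (by linarith) (by linarith)) (sp (by linarith) (by linarith))
  · exact sp' (by linarith) (by linarith)
  · exact mul_nonpos_of_nonpos_of_nonneg (sn' h1 (by linarith)) (sp' (by linarith) h2)
  · left
    exact mul_nonneg (sp' (by linarith) h3) (sp' (by linarith) (by linarith))

lemma cell4b {a1 a2 b1 b2 g1 g2 s : ℝ} (hS : a1 + a2 + b1 + b2 + g1 + g2 + 3 * s = 4 * π)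
    (ha2 : 0 < a2) (ha : a2 < a1) (ha1 : a1 < 2 * π)
    (hb2 : 0 < b2) (hb : b2 < b1) (hb1 : b1 < 2 * π)
    (hg2 : 0 < g2) (hg : g2 < g1) (hg1 : g1 < 2 * π) (hs : 0 < s)
    (H1 : a1 + b2 + g2 + s < 2 * π) (H2 : a2 + b1 + g2 + s < 2 * π)
    (H3 : a2 + b2 + g1 + s < 2 * π) (H4 : 2 * π < a1 + b1 + g1 + s) :
    VV a1 a2 b1 b2 g1 g2 s := by
  by_cases c1 : 2 * π ≤ a2 + b1 + g1 + s
  · refine VC_swap1 (cell4_core (a := a2) (a' := a1) ?_ ?_ ?_ ?_ ?_ ?_ ?_ ?_ ?_ ?_ ?_ ?_ ?_ ?_) <;>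
      linarith
  by_cases c2 : 2 * π ≤ a1 + b2 + g1 + s
  · refine VV_rot (VC_swap1 (cell4_core (a := b2) (a' := b1) ?_ ?_ ?_ ?_ ?_ ?_ ?_ ?_ ?_ ?_ ?_ ?_ ?_ ?_)) <;>
      linarith
  by_cases c3 : 2 * π ≤ a1 + b1 + g2 + s
  · refine VV_rot (VV_rot (VC_swap1 (cell4_core (a := g2) (a' := g1) ?_ ?_ ?_ ?_ ?_ ?_ ?_ ?_ ?_ ?_ ?_ ?_ ?_ ?_))) <;>
      linarith
  · refine cell4_core ?_ ?_ ?_ ?_ ?_ ?_ ?_ ?_ ?_ ?_ ?_ ?_ ?_ ?_ <;> linarith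

lemma cell6_core {a1 a2 b1 b2 g1 g2 s : ℝ} (hS : a1 + a2 + b1 + b2 + g1 + g2 + 3 * s = 6 * π)
    (ha2 : 0 < a2) (ha : a2 < a1) (ha1 : a1 < 2 * π)
    (hb2 : 0 < b2) (hb : b2 < b1) (hb1 : b1 < 2 * π)
    (hg2 : 0 < g2) (hg : g2 < g1) (hg1 : g1 < 2 * π) (hs : 0 ≤ s)
    (H1 : a2 + b2 + g2 + s < 2 * π) (H2 : 4 * π < a1 + b1 + g1 + s)
    (H3 : a1 + b2 + g1 + s ≤ 4 * π) (H4 : a1 + b1 + g2 + s ≤ 4 * π) :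
    VV a1 a2 b1 b2 g1 g2 s := by
  have e : ex (a1 + a2 + b1 + b2 + g1 + g2 + 3 * s) = 1 := by rw [hS, ex_6pi]
  rcases hs.eq_or_lt with rfl | hs
  · have e' : ex (a1 + a2 + b1 + b2 + g1 + g2) = 1 := by simpa using e
    unfold VV
    rw [neg_zero, ex_zero]
    have hg1' : Real.sin ((a1 + b1 + g1) / 2) * Real.sin ((a1 + b2 + g1) / 2) ≤ 0 :=
      mul_nonpos_of_nonneg_of_nonpos (sq4 (by linarith) (by linarith)).le
        (sn' (by linarith) (by linarith))
    by_cases c : 2 * π ≤ a1 + b2 + g2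
    · refine AL_cross a1 a2 b1 b2 g1 g2 e' ?_ ?_ ?_ ?_ hg1' ?_
      · exact (sp (by linarith) (by linarith)).ne'
      · exact (sp (by linarith) (by linarith)).ne'
      · exact (sp (by linarith) (by linarith)).ne'
      · exact (sp (by linarith) (by linarith)).ne'
      · exact mul_nonneg_of_nonpos_of_nonpos (sn' (by linarith) (by linarith))
          (sn' (by linarith) (by linarith))
    · refine AL0 a1 a2 b1 b2 g1 g2 e' ?_ ?_ ?_ ?_ ?_ ?_ ?_ ?_ ?_ hg1' ?_
      · exact (sp (by linarith) (by linarith))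
      · exact (sp (by linarith) (by linarith))
      · exact (sp (by linarith) (by linarith))
      · exact (sp (by linarith) (by linarith)).ne'
      · exact (sp (by linarith) (by linarith))
      · exact (sp (by linarith) (by linarith))
      · exact (sp (by linarith) (by linarith))
      · exact (sp (by linarith) (by linarith))
      · exact (sn (by linarith) (by linarith))
      · have h1 : 0 < Real.sin ((a1 + b2 + g2) / 2) := sp (by linarith) (by linarith)
        exact mul_neg_of_neg_of_pos (sn (by linarith) (by linarith)) h1
  · refine AL a1 a2 b1 b2 g1 g2 s e ?_ ?_ ?_ ?_ ?_ ?_ ?_ ?_ ?_ ?_ ?_ ?_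
    · exact sp ha2 (by linarith)
    · exact sp (by linarith) hb1
    · exact sp hb2 (by linarith)
    · exact (sp (by linarith) (by linarith)).ne'
    · exact sp (by linarith) (by linarith)
    · exact sp hg2 (by linarith)
    · exact mul_pos (sp (by linarith) (by linarith)) (sp (by linarith) (by linarith))
    · exact sp (by linarith) (by linarith)
    · rw [show (a2 + g2) / 2 + s = (a2 + g2 + 2 * s) / 2 by ring]
      exact mul_pos (sp (by linarith) (by linarith)) (sp (by linarith) (by linarith))
    · exact sp' (by linarith) (by linarith)
    · exact mul_nonpos_of_nonneg_of_nonpos (sq4 (by linarith) (by linarith)).le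
        (sn' (by linarith) (by linarith))
    · by_cases c : 2 * π ≤ a1 + b2 + (s + g2)
      · left
        exact mul_nonneg_of_nonpos_of_nonpos (sn' (by linarith) (by linarith))
          (sn' (by linarith) (by linarith))
      · right
        rw [show (a2 + g1) / 2 + s = (a2 + g1 + 2 * s) / 2 by ring]
        exact mul_nonpos_of_nonneg_of_nonpos (sp (by linarith) (by linarith)).le
          (sn' (by linarith) (by linarith))

lemma cell6_pos {a1 a2 b1 b2 g1 g2 s : ℝ} (hS : a1 + a2 + b1 + b2 + g1 + g2 + 3 * s = 6 * π)
    (ha2 : 0 < a2) (ha : a2 < a1) (ha1 : a1 < 2 * π)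
    (hb2 : 0 < b2) (hb : b2 < b1) (hb1 : b1 < 2 * π)
    (hg2 : 0 < g2) (hg : g2 < g1) (hg1 : g1 < 2 * π) (hs : 0 ≤ s)
    (H1 : a2 + b2 + g2 + s < 2 * π) (H2 : 4 * π < a1 + b1 + g1 + s) :
    VV a1 a2 b1 b2 g1 g2 s := by
  by_cases c2 : a1 + b2 + g1 + s ≤ 4 * π
  · by_cases c3 : a1 + b1 + g2 + s ≤ 4 * π
    · refine cell6_core ?_ ?_ ?_ ?_ ?_ ?_ ?_ ?_ ?_ ?_ ?_ ?_ ?_ ?_ ?_ <;> linarith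
    · refine VV_rot (VV_rot (cell6_core ?_ ?_ ?_ ?_ ?_ ?_ ?_ ?_ ?_ ?_ ?_ ?_ ?_ ?_ ?_)) <;>
        linarith
  · refine VV_rot (cell6_core ?_ ?_ ?_ ?_ ?_ ?_ ?_ ?_ ?_ ?_ ?_ ?_ ?_ ?_ ?_) <;> linarith

lemma cell6 {a1 a2 b1 b2 g1 g2 s : ℝ} (hS : a1 + a2 + b1 + b2 + g1 + g2 + 3 * s = 6 * π)
    (ha2 : 0 < a2) (ha : a2 < a1) (ha1 : a1 < 2 * π)
    (hb2 : 0 < b2) (hb : b2 < b1) (hb1 : b1 < 2 * π)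
    (hg2 : 0 < g2) (hg : g2 < g1) (hg1 : g1 < 2 * π)
    (H1 : a2 + b2 + g2 + s < 2 * π) (H2 : 4 * π < a1 + b1 + g1 + s) :
    VV a1 a2 b1 b2 g1 g2 s := by
  rcases le_total 0 s with hs | hs
  · exact cell6_pos hS ha2 ha ha1 hb2 hb hb1 hg2 hg hg1 hs H1 H2
  · refine VV_dual (cell6_pos ?_ ?_ ?_ ?_ ?_ ?_ ?_ ?_ ?_ ?_ ?_ ?_ ?_) <;> linarith

lemma omg_ex : omg = ex (2 * π / 3) := by
  unfold omg ex; congr 1; push_cast; ring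

/-- Full cells: the polytopes are contained in the corresponding solution sets. -/
theorem full_cells :
    P4 ∩ {τ : Tri | memTo3 τ} ⊆ Psol omg ∧
    P6 ∩ {τ : Tri | memTo3 τ} ⊆ Psol 1 ∧
    P8 ∩ {τ : Tri | memTo3 τ} ⊆ Psol (omg ^ 2) := by
  refine ⟨?_, ?_, ?_⟩
  · rintro τ ⟨⟨hT, h⟩, ⟨ha2, ha, ha1⟩, ⟨hb2, hb, hb1⟩, ⟨hg2, hg, hg1⟩⟩
    have hu : omg = ex (-((4 * π - Sf τ) / 3) - Sf τ / 3) := by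
      rw [omg_ex, show 2 * π / 3 = 2 * π + (-((4 * π - Sf τ) / 3) - Sf τ / 3) by ring, ex_add,
        ex_2pi, one_mul]
    refine Psol_of_VV hT ?_ hu
    simp [Hf, sg, coord, Sf] at h
    rcases h with h | ⟨h0, h1, h2, h3, h4⟩
    · refine cell4a ?_ ha2 ha ha1 hb2 hb hb1 hg2 hg hg1 ?_
      · unfold Sf; ring
      · linarith
    · refine cell4b ?_ ha2 ha ha1 hb2 hb hb1 hg2 hg hg1 ?_ ?_ ?_ ?_ ?_
      · unfold Sf; ring
      all_goals unfold Sf; linarith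
  · rintro τ ⟨⟨hT, h1, h2⟩, ⟨ha2, ha, ha1⟩, ⟨hb2, hb, hb1⟩, ⟨hg2, hg, hg1⟩⟩
    have hu : (1 : ℂ) = ex (-((6 * π - Sf τ) / 3) - Sf τ / 3) := by
      rw [← ex_zero, show (0 : ℝ) = 2 * π + (-((6 * π - Sf τ) / 3) - Sf τ / 3) by ring, ex_add,
        ex_2pi, one_mul]
    refine Psol_of_VV hT ?_ hu
    simp [Hf, sg, coord] at h1 h2
    refine cell6 ?_ ha2 ha ha1 hb2 hb hb1 hg2 hg hg1 ?_ ?_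
    · unfold Sf; ring
    all_goals unfold Sf; linarith
  · rintro τ ⟨⟨hT, h⟩, ⟨ha2, ha, ha1⟩, ⟨hb2, hb, hb1⟩, ⟨hg2, hg, hg1⟩⟩
    have hu : omg ^ 2 = ex (-((8 * π - Sf τ) / 3) - Sf τ / 3) := by
      rw [omg_ex, pow_two, ← ex_add,
        show 2 * π / 3 + 2 * π / 3 = 4 * π + (-((8 * π - Sf τ) / 3) - Sf τ / 3) by ring, ex_add,
        ex_4pi, one_mul]
    refine Psol_of_VV hT (VV_dual ?_) hu
    simp [Hf, sg, coord, Sf] at h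
    rcases h with h | ⟨h0, h1, h2, h3, h4⟩
    · refine cell4a ?_ ?_ ?_ ?_ ?_ ?_ ?_ ?_ ?_ ?_ ?_
      · unfold Sf; ring
      all_goals linarith
    · refine cell4b ?_ ?_ ?_ ?_ ?_ ?_ ?_ ?_ ?_ ?_ ?_ ?_ ?_ ?_ ?_
      · unfold Sf; ring
      all_goals (try unfold Sf); linarith
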